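/- Non-stationary Furstenberg theorem. Assume that the compact set K of Borel probability measures on SL(d,ℝ) satisfies the finite moment condition, the measures condition, and the spaces condition. Then there exists λ > 0 such that for every n and every choice of μ₁, …, μₙ ∈ K one has Lₙ ≥ nλ; moreover, for any fixed sequence (μᵢ)_{i∈ℕ} of measures from K, almost surely with respect to the infinite product measure μ₁ × μ₂ × ⋯ one has lim_{n→∞} (1/n)(log‖Tₙ‖ − Lₙ) = 0. -/

import Mathlib

open MeasureTheory Matrix Filter
open scoped ENNReal

noncomputable section

/-- `SL(d, ℝ)`. -/
abbrev SL (d : ℕ) := Matrix.SpecialLinearGroup (Fin d) ℝ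

instance (d : ℕ) : TopologicalSpace (SL d) :=
  inferInstanceAs (TopologicalSpace { A : Matrix (Fin d) (Fin d) ℝ // A.det = 1 })

instance (d : ℕ) : MeasurableSpace (SL d) := borel _
instance (d : ℕ) : BorelSpace (SL d) := ⟨rfl⟩

/-- Operator norm of a real `d × d` matrix, acting on Euclidean space. -/
def opNorm {d : ℕ} (A : Matrix (Fin d) (Fin d) ℝ) : ℝ :=
  ‖Matrix.toEuclideanCLM (𝕜 := ℝ) A‖

/-- The norm `‖A‖` of `A ∈ SL(d, ℝ)`. -/
def slNorm {d : ℕ} (A : SL d) : ℝ := opNorm (A : Matrix (Fin d) (Fin d) ℝ)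

/-- `A` applied to a vector `v ∈ ℝ^d` (with the Euclidean norm). -/
def slVec {d : ℕ} (A : SL d) (v : EuclideanSpace ℝ (Fin d)) : EuclideanSpace ℝ (Fin d) :=
  Matrix.toEuclideanCLM (𝕜 := ℝ) (A : Matrix (Fin d) (Fin d) ℝ) v

/-- The random (reversed) product `Tₙ = Aₙ ⋯ A₂ A₁`, where `Aᵢ = ω (i-1)`. -/
def T {d : ℕ} (ω : ℕ → SL d) : ℕ → SL d
  | 0 => 1
  | n + 1 => ω n * T ω n

/-- The projective space `ℝP^{d-1}`. -/
abbrev Proj (d : ℕ) := Projectivization ℝ (Fin d → ℝ)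

instance (d : ℕ) : TopologicalSpace (Proj d) :=
  inferInstanceAs (TopologicalSpace (Quotient (projectivizationSetoid ℝ (Fin d → ℝ))))

instance (d : ℕ) : MeasurableSpace (Proj d) := borel _
instance (d : ℕ) : BorelSpace (Proj d) := ⟨rfl⟩

/-- The linear map induced by `A ∈ SL(d, ℝ)` is injective. -/
theorem toLin'_injective {d : ℕ} (A : SL d) :
    Function.Injective (Matrix.toLin' (A : Matrix (Fin d) (Fin d) ℝ)) := by
  apply Function.LeftInverse.injective
    (g := Matrix.toLin' ((A⁻¹ : SL d) : Matrix (Fin d) (Fin d) ℝ))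
  intro x
  rw [← Matrix.toLin'_mul_apply, ← Matrix.SpecialLinearGroup.coe_mul, inv_mul_cancel,
    Matrix.SpecialLinearGroup.coe_one, Matrix.toLin'_one, LinearMap.id_apply]

/-- The projective map `f_A : ℝP^{d-1} → ℝP^{d-1}` induced by `A ∈ SL(d, ℝ)`. -/
def projMap {d : ℕ} (A : SL d) : Proj d → Proj d :=
  Projectivization.map (Matrix.toLin' (A : Matrix (Fin d) (Fin d) ℝ)) (toLin'_injective A)

/-- The subset `[L] ⊆ ℝP^{d-1}` corresponding to a linear subspace `L ≤ ℝ^d`. -/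
def projSet {d : ℕ} (L : Submodule ℝ (Fin d → ℝ)) : Set (Proj d) :=
  {x : Proj d | x.submodule ≤ L}

/-- Finite moment condition for a single measure, with exponent `γ` and bound `C`. -/
def FiniteMomentCondition {d : ℕ} (γ C : ℝ) (μ : ProbabilityMeasure (SL d)) : Prop :=
  ∫⁻ A, ENNReal.ofReal (slNorm A ^ γ) ∂(μ : Measure (SL d)) < ENNReal.ofReal C

/-- Log-moment condition: `∫ log ‖A‖ dμ(A) < ∞`. -/
def LogMomentCondition {d : ℕ} (μ : ProbabilityMeasure (SL d)) : Prop :=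
  ∫⁻ A, ENNReal.ofReal (Real.log (slNorm A)) ∂(μ : Measure (SL d)) < ⊤

/-- Measures condition: there are no Borel probability measures `ν₁`, `ν₂` on `ℝP^{d-1}`
with `(f_A)_* ν₁ = ν₂` for `μ`-a.e. `A`. -/
def MeasuresCondition {d : ℕ} (μ : ProbabilityMeasure (SL d)) : Prop :=
  ¬ ∃ (ν₁ ν₂ : ProbabilityMeasure (Proj d)),
      ∀ᵐ A ∂(μ : Measure (SL d)),
        (ν₁ : Measure (Proj d)).map (projMap A) = (ν₂ : Measure (Proj d))

/-- `U ⊆ ℝ^d` is a (nonempty) finite union of proper nonzero linear subspaces. -/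
def IsFiniteUnionOfProperSubspaces {d : ℕ} (U : Set (Fin d → ℝ)) : Prop :=
  ∃ S : Set (Submodule ℝ (Fin d → ℝ)), S.Finite ∧ S.Nonempty ∧
    (∀ W ∈ S, W ≠ ⊥ ∧ W ≠ ⊤) ∧ U = ⋃ W ∈ S, (W : Set (Fin d → ℝ))

/-- `U ⊆ ℝ^d` is a (nonempty) finite union of `j`-dimensional linear subspaces. -/
def IsFiniteUnionOfDimSubspaces {d : ℕ} (j : ℕ) (U : Set (Fin d → ℝ)) : Prop :=
  ∃ S : Set (Submodule ℝ (Fin d → ℝ)), S.Finite ∧ S.Nonempty ∧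
    (∀ W ∈ S, Module.finrank ℝ W = j) ∧ U = ⋃ W ∈ S, (W : Set (Fin d → ℝ))

/-- Spaces condition: there are no two finite unions `U`, `U'` of proper nonzero subspaces
of `ℝ^d` such that `A(U) = U'` for `μ`-a.e. `A`. -/
def SpacesCondition {d : ℕ} (μ : ProbabilityMeasure (SL d)) : Prop :=
  ¬ ∃ U U' : Set (Fin d → ℝ), IsFiniteUnionOfProperSubspaces U ∧
      IsFiniteUnionOfProperSubspaces U' ∧
      ∀ᵐ (A : SL d) ∂(μ : Measure (SL d)),
        (fun v => Matrix.toLin' (A : Matrix (Fin d) (Fin d) ℝ) v) '' U = U'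

/-- `ℙ` is the product measure `μ₁ × μ₂ × ⋯` on sequences, characterized by its
finite-dimensional marginals. -/
def IsProductMeasure {d : ℕ} (μ : ℕ → ProbabilityMeasure (SL d))
    (ℙ : Measure (ℕ → SL d)) : Prop :=
  IsProbabilityMeasure ℙ ∧
    ∀ n : ℕ, ℙ.map (fun ω (i : Fin n) => ω i) =
      Measure.pi (fun i : Fin n => ((μ i : Measure (SL d))))

/-- `Lₙ = E log ‖Tₙ‖`. -/
def L {d : ℕ} (ℙ : Measure (ℕ → SL d)) (n : ℕ) : ℝ :=
  ∫ ω, Real.log (slNorm (T ω n)) ∂ℙ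

/-- `L_{[n,m]} = E log ‖A_m ⋯ A_{n+1}‖`. -/
def Lseg {d : ℕ} (ℙ : Measure (ℕ → SL d)) (n m : ℕ) : ℝ :=
  ∫ ω, Real.log (slNorm (T ω m * (T ω n)⁻¹)) ∂ℙ

open scoped RealInnerProductSpace Topology

/-! ### Special linear matrices acting on Euclidean space -/

/-- `d`-dimensional Euclidean space. -/
abbrev Euc (d : ℕ) := EuclideanSpace ℝ (Fin d)

/-- The unit sphere of `d`-dimensional Euclidean space. -/
abbrev Sph (d : ℕ) := Metric.sphere (0 : Euc d) 1

/-- The continuous linear map of Euclidean space attached to a special linear matrix. -/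
def slCLM {d : ℕ} (A : SL d) : Euc d →L[ℝ] Euc d :=
  Matrix.toEuclideanCLM (𝕜 := ℝ) (A : Matrix (Fin d) (Fin d) ℝ)

section Basics

variable {d : ℕ}

theorem isClosedEmbedding_slCoe :
    Topology.IsClosedEmbedding ((↑) : SL d → Matrix (Fin d) (Fin d) ℝ) :=
  Matrix.SpecialLinearGroup.isClosedEmbedding_val

instance : IsTopologicalGroup (SL d) := Matrix.SpecialLinearGroup.topologicalGroup

instance : SecondCountableTopology (SL d) :=
  have : SecondCountableTopology (Matrix (Fin d) (Fin d) ℝ) :=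
    inferInstanceAs (SecondCountableTopology (Fin d → Fin d → ℝ))
  (isClosedEmbedding_slCoe (d := d)).isEmbedding.secondCountableTopology

instance : TopologicalSpace.MetrizableSpace (SL d) :=
  have : TopologicalSpace.MetrizableSpace (Matrix (Fin d) (Fin d) ℝ) :=
    inferInstanceAs (TopologicalSpace.MetrizableSpace (Fin d → Fin d → ℝ))
  (isClosedEmbedding_slCoe (d := d)).isEmbedding.metrizableSpace

theorem slNorm_eq (A : SL d) : slNorm A = ‖slCLM A‖ := rfl

theorem slVec_eq (A : SL d) (v : Euc d) : slVec A v = slCLM A v := rfl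

theorem slCLM_mul (A B : SL d) : slCLM (A * B) = slCLM A * slCLM B := by
  simp [slCLM]

theorem slCLM_one : slCLM (1 : SL d) = 1 := by
  simp [slCLM]

@[fun_prop]
theorem continuous_slCLM : Continuous (slCLM : SL d → _) := by
  have h : Continuous (Matrix.toEuclideanCLM (n := Fin d) (𝕜 := ℝ)) :=
    LinearMap.continuous_of_finiteDimensional
      (Matrix.toEuclideanCLM (n := Fin d) (𝕜 := ℝ)).toAlgEquiv.toLinearMap
  exact h.comp isClosedEmbedding_slCoe.continuous

@[fun_prop]
theorem continuous_slNorm : Continuous (slNorm : SL d → ℝ) := by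
  simp only [funext slNorm_eq]
  fun_prop

theorem Continuous.slVec_apply {X : Type*} [TopologicalSpace X] {f : X → SL d} {g : X → Euc d}
    (hf : Continuous f) (hg : Continuous g) :
    Continuous (fun x => (slVec (f x) (g x) : Euc d)) :=
  (continuous_slCLM.comp hf).clm_apply hg

theorem slVec_mul (A B : SL d) (v : Euc d) : slVec (A * B) v = slVec A (slVec B v) := by
  simp [slVec_eq, slCLM_mul]

@[simp]
theorem slVec_one (v : Euc d) : slVec 1 v = v := by
  simp [slVec_eq, slCLM_one]

@[simp]
theorem slVec_inv_slVec (A : SL d) (v : Euc d) : slVec A⁻¹ (slVec A v) = v := by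
  simp [← slVec_mul]

@[simp]
theorem slVec_slVec_inv (A : SL d) (v : Euc d) : slVec A (slVec A⁻¹ v) = v := by
  simp [← slVec_mul]

theorem slVec_smul (A : SL d) (c : ℝ) (v : Euc d) : slVec A (c • v) = c • slVec A v := by
  simp [slVec_eq]

@[simp]
theorem slVec_eq_zero_iff (A : SL d) (v : Euc d) : slVec A v = 0 ↔ v = 0 := by
  refine ⟨fun h => ?_, fun h => by simp [slVec_eq, h]⟩
  rw [← slVec_inv_slVec A v, h]
  simp [slVec_eq]

theorem slNorm_nonneg (A : SL d) : 0 ≤ slNorm A := norm_nonneg _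

theorem norm_slVec_le (A : SL d) (v : Euc d) : ‖slVec A v‖ ≤ slNorm A * ‖v‖ :=
  (slCLM A).le_opNorm v

theorem slNorm_mul_le (A B : SL d) : slNorm (A * B) ≤ slNorm A * slNorm B := by
  simp only [slNorm_eq, slCLM_mul]
  exact norm_mul_le _ _

theorem slNorm_one [NeZero d] : slNorm (1 : SL d) = 1 := by
  simp [slNorm_eq, slCLM_one]

theorem slCLM_det (A : SL d) : LinearMap.det (slCLM A : Euc d →ₗ[ℝ] Euc d) = 1 := by
  have : (slCLM A : Euc d →ₗ[ℝ] Euc d) =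
      Matrix.toLin (EuclideanSpace.basisFun (Fin d) ℝ).toBasis
        (EuclideanSpace.basisFun (Fin d) ℝ).toBasis (A : Matrix (Fin d) (Fin d) ℝ) := by
    rw [← Matrix.toEuclideanLin_eq_toLin_orthonormal]
    rfl
  rw [this, LinearMap.det_toLin, A.2]

/-- Hadamard's inequality bounds from below the image of a vector under a special linear map. -/
theorem norm_le_mul_norm_slVec [NeZero d] (A : SL d) (v : Euc d) :
    ‖v‖ ≤ slNorm A ^ (d - 1) * ‖slVec A v‖ := by
  rcases eq_or_ne v 0 with rfl | hv
  · simp [slVec_eq]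
  have hfact : Fact (Module.finrank ℝ (Euc d) = d) := ⟨by simp⟩
  have hunit : ∀ u : Euc d, ‖u‖ = 1 → 1 ≤ slNorm A ^ (d - 1) * ‖slVec A u‖ := by
    intro u hu
    obtain ⟨b, hb⟩ := Orthonormal.exists_orthonormalBasis_extension_of_card_eq (𝕜 := ℝ)
      (E := Euc d) (ι := Fin d) (by simp) (v := fun _ => u) (s := {0})
      (by
        rw [orthonormal_iff_ite]
        rintro ⟨i, hi⟩ ⟨j, hj⟩
        simp only [Set.mem_singleton_iff] at hi hj
        subst hi hj
        simp [hu])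
    have h0 : b 0 = u := hb 0 rfl
    have hdet := b.toBasis.det_comp (slCLM A : Euc d →ₗ[ℝ] Euc d) b
    rw [slCLM_det, one_mul, ← b.coe_toBasis, Module.Basis.det_self] at hdet
    have hle := (b.toBasis.orientation).abs_volumeForm_apply_le (fun i => slCLM A (b i))
    rw [Orientation.volumeForm_robust _ b rfl] at hle
    have heq : b.toBasis.det (fun i => slCLM A (b i)) = 1 := by
      rw [← hdet, b.coe_toBasis]; rfl
    rw [heq, abs_one, ← Finset.mul_prod_erase _ _ (Finset.mem_univ (0 : Fin d)), h0, mul_comm]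
      at hle
    refine hle.trans (mul_le_mul_of_nonneg_right ?_ (norm_nonneg _))
    calc ∏ i ∈ Finset.univ.erase (0 : Fin d), ‖slCLM A (b i)‖
        ≤ ∏ _i ∈ Finset.univ.erase (0 : Fin d), slNorm A := by
          refine Finset.prod_le_prod (fun _ _ => norm_nonneg _) fun i _ => ?_
          simpa [slVec_eq] using norm_slVec_le A (b i)
      _ = slNorm A ^ (d - 1) := by simp
  have h := hunit (‖v‖⁻¹ • v) (by simp [norm_smul, hv])
  rw [slVec_smul, norm_smul, norm_inv, norm_norm] at h
  have hv' : 0 < ‖v‖ := by positivity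
  field_simp at h
  linarith

theorem slNorm_inv_le [NeZero d] (A : SL d) : slNorm A⁻¹ ≤ slNorm A ^ (d - 1) := by
  refine (slCLM A⁻¹).opNorm_le_bound (pow_nonneg (slNorm_nonneg A) _) fun v => ?_
  simpa [← slVec_eq] using norm_le_mul_norm_slVec A (slVec A⁻¹ v)

theorem one_le_slNorm [NeZero d] (A : SL d) : 1 ≤ slNorm A := by
  by_contra! h
  have h1 : (1 : ℝ) ≤ slNorm A ^ (d - 1) * slNorm A := by
    have := slNorm_mul_le A⁻¹ A
    rw [inv_mul_cancel, slNorm_one] at this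
    exact this.trans (mul_le_mul_of_nonneg_right (slNorm_inv_le A) (slNorm_nonneg A))
  have h2 : slNorm A ^ (d - 1) ≤ 1 := pow_le_one₀ (slNorm_nonneg A) h.le
  nlinarith [slNorm_nonneg A]

theorem slNorm_pos [NeZero d] (A : SL d) : 0 < slNorm A :=
  zero_lt_one.trans_le (one_le_slNorm A)

theorem log_slNorm_nonneg [NeZero d] (A : SL d) : 0 ≤ Real.log (slNorm A) :=
  Real.log_nonneg (one_le_slNorm A)

theorem log_slNorm_mul_le [NeZero d] (A B : SL d) :
    Real.log (slNorm (A * B)) ≤ Real.log (slNorm A) + Real.log (slNorm B) := by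
  rw [← Real.log_mul (slNorm_pos A).ne' (slNorm_pos B).ne']
  exact Real.log_le_log (slNorm_pos _) (slNorm_mul_le A B)

/-- The action of a special linear matrix on the unit sphere. -/
def sphMap (A : SL d) (x : Sph d) : Sph d :=
  ⟨‖slVec A x‖⁻¹ • slVec A x, by
    have : (x : Euc d) ≠ 0 := ne_zero_of_mem_unit_sphere x
    simp [norm_smul, this]⟩

theorem norm_slVec_pos (A : SL d) (x : Sph d) : 0 < ‖slVec A x‖ := by
  have : (x : Euc d) ≠ 0 := ne_zero_of_mem_unit_sphere x
  simp [this]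

theorem coe_sphMap (A : SL d) (x : Sph d) :
    (sphMap A x : Euc d) = ‖slVec A x‖⁻¹ • slVec A x := rfl

theorem slVec_eq_smul_sphMap (A : SL d) (x : Sph d) :
    slVec A x = ‖slVec A x‖ • (sphMap A x : Euc d) := by
  rw [coe_sphMap, smul_inv_smul₀ (norm_slVec_pos A x).ne']

theorem sphMap_mul (A B : SL d) (x : Sph d) : sphMap (A * B) x = sphMap A (sphMap B x) := by
  ext1
  have hB := (norm_slVec_pos B x).ne'
  simp only [coe_sphMap, slVec_mul, slVec_smul, norm_smul, smul_smul, norm_inv, norm_norm]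
  congr 1
  field_simp

theorem norm_slVec_mul (A B : SL d) (x : Sph d) :
    ‖slVec (A * B) x‖ = ‖slVec A (sphMap B x)‖ * ‖slVec B x‖ := by
  rw [slVec_mul, slVec_eq_smul_sphMap B x, slVec_smul, norm_smul, norm_norm, mul_comm]
  congr 1
  rw [← slVec_eq_smul_sphMap]

@[fun_prop]
theorem continuous_sphMap :
    Continuous (fun p : SL d × Sph d => (sphMap p.1 p.2 : Sph d)) := by
  have h : Continuous (fun p : SL d × Sph d => (slVec p.1 p.2 : Euc d)) :=
    continuous_fst.slVec_apply (continuous_subtype_val.comp continuous_snd)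
  exact ((h.norm.inv₀ fun p => (norm_slVec_pos p.1 p.2).ne').smul h).subtype_mk _

theorem norm_slVec_le_slNorm (A : SL d) (x : Sph d) : ‖slVec A x‖ ≤ slNorm A := by
  simpa using norm_slVec_le A x

/-- Up to sign, the logarithmic expansion of a unit vector is at most `(d-1) log ‖A‖`. -/
theorem neg_log_norm_slVec_le [NeZero d] (A : SL d) (x : Sph d) :
    -Real.log ‖slVec A x‖ ≤ (d - 1 : ℕ) * Real.log (slNorm A) := by
  have h := norm_le_mul_norm_slVec A x
  rw [norm_eq_of_mem_sphere] at h
  have h2 := Real.log_le_log one_pos h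
  rw [Real.log_one, Real.log_mul (pow_pos (slNorm_pos A) _).ne' (norm_slVec_pos A x).ne',
    Real.log_pow] at h2
  linarith

end Basics

/-! ### Laws of random products -/

section Laws

open Measure

variable {d : ℕ}

/-- The law of `Aₙ ⋯ A₁` for independent `Aᵢ` with laws `μ (i-1)`. -/
def convLaw (μ : ℕ → ProbabilityMeasure (SL d)) : ℕ → Measure (SL d)
  | 0 => dirac 1
  | n + 1 => (μ n : Measure (SL d)) ∗ₘ convLaw μ n

instance isProbabilityMeasure_convLaw (μ : ℕ → ProbabilityMeasure (SL d)) (n : ℕ) :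
    IsProbabilityMeasure (convLaw μ n) := by
  induction n with
  | zero => unfold convLaw; infer_instance
  | succ n ih => unfold convLaw; infer_instance

theorem convLaw_add (μ : ℕ → ProbabilityMeasure (SL d)) (n m : ℕ) :
    convLaw μ (n + m) = convLaw (fun i => μ (n + i)) m ∗ₘ convLaw μ n := by
  induction m with
  | zero => simp [convLaw]
  | succ m ih =>
    rw [← add_assoc, convLaw, ih, convLaw, mconv_assoc]

/-- The product of the entries of a finite family of matrices, in reversed order. -/
def finProd : (n : ℕ) → (Fin n → SL d) → SL d
  | 0, _ => 1
  | n + 1, f => f (Fin.last n) * finProd n fun i => f i.castSucc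

theorem T_eq_finProd (ω : ℕ → SL d) (n : ℕ) : T ω n = finProd n fun i => ω i := by
  induction n with
  | zero => rfl
  | succ n ih => simp [T, finProd, ih]

theorem measurable_finProd (n : ℕ) : Measurable (finProd n : (Fin n → SL d) → SL d) := by
  induction n with
  | zero => exact measurable_const
  | succ n ih =>
    change Measurable fun f : Fin (n + 1) → SL d =>
      f (Fin.last n) * finProd n fun i => f i.castSucc
    exact (measurable_pi_apply _).mul
      (ih.comp (measurable_pi_lambda _ fun i => measurable_pi_apply _))

theorem measurable_T (n : ℕ) : Measurable fun ω : ℕ → SL d => T ω n := by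
  simp only [T_eq_finProd]
  exact (measurable_finProd n).comp (measurable_pi_lambda _ fun i => measurable_pi_apply _)

theorem map_finProd (μ : ℕ → ProbabilityMeasure (SL d)) (n : ℕ) :
    (Measure.pi fun i : Fin n => (μ i : Measure (SL d))).map (finProd n) = convLaw μ n := by
  induction n with
  | zero =>
    rw [Measure.pi_of_empty _ (fun i => i.elim0), Measure.map_dirac' (measurable_finProd 0)]
    rfl
  | succ n ih =>
    have hmp := measurePreserving_piFinSuccAbove
      (fun i : Fin (n + 1) => (μ i : Measure (SL d))) (Fin.last n)
    have hfun : (finProd (n + 1) : (Fin (n + 1) → SL d) → SL d) =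
        (fun p : SL d × SL d => p.1 * p.2) ∘ (Prod.map id (finProd n)) ∘
          (MeasurableEquiv.piFinSuccAbove (fun _ => SL d) (Fin.last n)) := by
      ext1 f
      simp only [finProd, Function.comp, MeasurableEquiv.piFinSuccAbove_apply, Prod.map, id]
      congr 2
      ext1 i
      exact (Fin.succAbove_last_apply i).symm ▸ rfl
    rw [hfun, ← Measure.map_map measurable_mul
      ((measurable_id.prodMap (measurable_finProd n)).comp
        (MeasurableEquiv.piFinSuccAbove (fun _ => SL d) (Fin.last n)).measurable),
      ← Measure.map_map (measurable_id.prodMap (measurable_finProd n))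
        (MeasurableEquiv.piFinSuccAbove (fun _ => SL d) (Fin.last n)).measurable, hmp.map_eq,
      ← Measure.map_prod_map _ _ measurable_id (measurable_finProd n)]
    simp only [Fin.succAbove_last, Fin.val_last, Fin.val_castSucc, ih, Measure.map_id]
    rfl

theorem IsProductMeasure.map_T {μ : ℕ → ProbabilityMeasure (SL d)} {ℙ : Measure (ℕ → SL d)}
    (h : IsProductMeasure μ ℙ) (n : ℕ) : ℙ.map (fun ω => T ω n) = convLaw μ n := by
  have hm : Measurable fun (ω : ℕ → SL d) (i : Fin n) => ω i :=
    measurable_pi_lambda _ fun i => measurable_pi_apply _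
  rw [← map_finProd, ← h.2 n, Measure.map_map (measurable_finProd n) hm]
  congr 1
  ext1 ω
  exact T_eq_finProd ω n

end Laws

/-! ### Convolution of measures on the group with measures on the sphere -/

section SphereConvolution

variable {d : ℕ}

theorem upperSemicontinuous_measure_of_isClosed {X : Type*} [MeasurableSpace X]
    [TopologicalSpace X] [OpensMeasurableSpace X] [HasOuterApproxClosed X] {F : Set X}
    (hF : IsClosed F) :
    UpperSemicontinuous fun ν : ProbabilityMeasure X => (ν : Measure X) F := by
  rw [upperSemicontinuous_iff_limsup_le]
  intro ν
  exact ProbabilityMeasure.limsup_measure_closed_le_of_tendsto tendsto_id hF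

theorem upperSemicontinuous_measure_section {X Y : Type*} [MeasurableSpace X]
    [TopologicalSpace X] [BorelSpace X] [SecondCountableTopology X]
    [TopologicalSpace.PseudoMetrizableSpace X] [MeasurableSpace Y]
    [TopologicalSpace Y] [BorelSpace Y] [SecondCountableTopology Y]
    [TopologicalSpace.PseudoMetrizableSpace Y] {F : Set (Y × X)} (hF : IsClosed F) :
    UpperSemicontinuous fun p : ProbabilityMeasure X × Y =>
      (p.1 : Measure X) {x | (p.2, x) ∈ F} := by
  have hc : Continuous fun p : ProbabilityMeasure X × Y => (diracProba p.2).prod p.1 :=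
    ProbabilityMeasure.continuous_prod.comp
      ((continuous_diracProba.comp continuous_snd).prodMk continuous_fst)
  have h := UpperSemicontinuous.comp (upperSemicontinuous_measure_of_isClosed hF) hc
  convert h using 2 with p
  change _ = ((Measure.dirac p.2).prod (p.1 : Measure X)) F
  rw [Measure.prod_apply hF.measurableSet,
    lintegral_dirac' _ (measurable_measure_prodMk_left hF.measurableSet)]
  rfl

/-- The law of the image of a random point of the sphere under an independent random matrix. -/
def sphConv (μ : ProbabilityMeasure (SL d)) (ν : ProbabilityMeasure (Sph d)) :
    ProbabilityMeasure (Sph d) :=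
  (μ.prod ν).map (f := fun p : SL d × Sph d => sphMap p.1 p.2)
    continuous_sphMap.measurable.aemeasurable

theorem continuous_sphConv :
    Continuous fun p : ProbabilityMeasure (SL d) × ProbabilityMeasure (Sph d) =>
      sphConv p.1 p.2 :=
  (ProbabilityMeasure.continuous_map continuous_sphMap).comp ProbabilityMeasure.continuous_prod

theorem measurable_sphMap (A : SL d) : Measurable (sphMap A) :=
  (continuous_sphMap.comp (Continuous.prodMk_right A)).measurable

theorem sphConv_apply (μ : ProbabilityMeasure (SL d)) (ν : ProbabilityMeasure (Sph d))
    {s : Set (Sph d)} (hs : MeasurableSet s) :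
    (sphConv μ ν : Measure (Sph d)) s =
      ∫⁻ A, (ν : Measure (Sph d)) (sphMap A ⁻¹' s) ∂(μ : Measure (SL d)) := by
  rw [sphConv, ProbabilityMeasure.toMeasure_map,
    Measure.map_apply continuous_sphMap.measurable hs, ProbabilityMeasure.toMeasure_prod,
    Measure.prod_apply (continuous_sphMap.measurable hs)]
  rfl

/-- Pairs of sequences `(μ, ν)` with `μ` in `K` and `ν j = μ j * ν (j+1)` for all `j < m`. -/
def chainsUpTo (K : Set (ProbabilityMeasure (SL d))) (m : ℕ∞) :
    Set ((ℕ → ProbabilityMeasure (SL d)) × (ℕ → ProbabilityMeasure (Sph d))) :=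
  {p | (∀ j, p.1 j ∈ K) ∧ ∀ j : ℕ, j < m → p.2 j = sphConv (p.1 j) (p.2 (j + 1))}

theorem isCompact_chainsUpTo {K : Set (ProbabilityMeasure (SL d))} (hK : IsCompact K) (m : ℕ∞) :
    IsCompact (chainsUpTo K m) := by
  have h : chainsUpTo K m = (Set.univ.pi (fun _ => K) ×ˢ Set.univ) ∩
      ⋂ (j : ℕ) (_ : j < m),
        {p : (ℕ → ProbabilityMeasure (SL d)) × (ℕ → ProbabilityMeasure (Sph d)) |
          p.2 j = sphConv (p.1 j) (p.2 (j + 1))} := by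
    ext p
    simp [chainsUpTo]
  rw [h]
  refine ((isCompact_univ_pi fun _ => hK).prod isCompact_univ).inter_right ?_
  refine isClosed_iInter fun j => isClosed_iInter fun _ => isClosed_eq (by fun_prop) ?_
  exact continuous_sphConv.comp (f := fun p : (ℕ → ProbabilityMeasure (SL d)) ×
      (ℕ → ProbabilityMeasure (Sph d)) => (p.1 j, p.2 (j + 1)))
    (((continuous_apply j).comp continuous_fst).prodMk
      ((continuous_apply (j + 1)).comp continuous_snd))

theorem shift_mem_chainsUpTo {K : Set (ProbabilityMeasure (SL d))}
    {p : (ℕ → ProbabilityMeasure (SL d)) × (ℕ → ProbabilityMeasure (Sph d))}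
    (hp : p ∈ chainsUpTo K ⊤) (k : ℕ) :
    ((fun j => p.1 (j + k), fun j => p.2 (j + k)) :
      (ℕ → ProbabilityMeasure (SL d)) × (ℕ → ProbabilityMeasure (Sph d))) ∈ chainsUpTo K ⊤ := by
  refine ⟨fun j => hp.1 _, fun j _ => ?_⟩
  have := hp.2 (j + k) (ENat.natCast_lt_top _)
  simpa only [add_right_comm j k 1] using this

/-- The trace of a linear subspace on the sphere. -/
def subSph (V : Submodule ℝ (Euc d)) : Set (Sph d) := {x | (x : Euc d) ∈ V}

theorem measurableSet_subSph (V : Submodule ℝ (Euc d)) : MeasurableSet (subSph V) :=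
  (V.closed_of_finiteDimensional.preimage continuous_subtype_val).measurableSet

/-- The linear automorphism attached to a special linear matrix. -/
def slEquiv (A : SL d) : Euc d ≃ₗ[ℝ] Euc d where
  toFun := slVec A
  invFun := slVec A⁻¹
  map_add' := by simp [slVec_eq]
  map_smul' := by simp [slVec_eq]
  left_inv v := by simp
  right_inv v := by simp

theorem mem_comap_slEquiv {A : SL d} {V : Submodule ℝ (Euc d)} {v : Euc d} :
    v ∈ V.comap (slEquiv A : Euc d →ₗ[ℝ] Euc d) ↔ slVec A v ∈ V := Iff.rfl

theorem preimage_subSph (A : SL d) (V : Submodule ℝ (Euc d)) :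
    sphMap A ⁻¹' subSph V = subSph (V.comap (slEquiv A : Euc d →ₗ[ℝ] Euc d)) := by
  ext x
  simp only [Set.mem_preimage, subSph, Set.mem_ofPred_eq, coe_sphMap, mem_comap_slEquiv]
  exact V.smul_mem_iff (inv_ne_zero (norm_slVec_pos A x).ne')

theorem finrank_comap_slEquiv (A : SL d) (V : Submodule ℝ (Euc d)) :
    Module.finrank ℝ (V.comap (slEquiv A : Euc d →ₗ[ℝ] Euc d)) = Module.finrank ℝ V := by
  rw [Submodule.comap_equiv_eq_map_symm]
  exact LinearEquiv.finrank_map_eq _ _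

theorem comap_slEquiv_injective (A : SL d) : Function.Injective
    fun V : Submodule ℝ (Euc d) => V.comap (slEquiv A : Euc d →ₗ[ℝ] Euc d) :=
  Submodule.comap_injective_of_surjective (slEquiv A).surjective

/-- Pairs of a tuple `y` of unit vectors and a unit vector `x` such that
`x = ∑ ⟪yᵢ, x⟫ yᵢ`. -/
def frameSet (d r : ℕ) : Set ((Fin r → Sph d) × Sph d) :=
  {p | (p.2 : Euc d) = ∑ i, ⟪(p.1 i : Euc d), (p.2 : Euc d)⟫ • (p.1 i : Euc d)}

theorem isClosed_frameSet (d r : ℕ) : IsClosed (frameSet d r) := by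
  unfold frameSet
  refine isClosed_eq (by fun_prop) ?_
  fun_prop

theorem isClosed_setOf_orthonormal (d r : ℕ) :
    IsClosed {y : Fin r → Sph d | Orthonormal ℝ fun i => (y i : Euc d)} := by
  simp only [orthonormal_iff_ite, Set.ofPred_forall]
  refine isClosed_iInter fun i => isClosed_iInter fun j => isClosed_eq ?_ continuous_const
  fun_prop

/-- Every subspace is described by an orthonormal tuple. -/
theorem exists_orthonormal_frame (V : Submodule ℝ (Euc d)) :
    ∃ y : Fin (Module.finrank ℝ V) → Sph d, (Orthonormal ℝ fun i => (y i : Euc d)) ∧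
      ∀ x ∈ subSph V, (y, x) ∈ frameSet d (Module.finrank ℝ V) := by
  let b := stdOrthonormalBasis ℝ V
  refine ⟨fun i => ⟨b i, mem_sphere_zero_iff_norm.2 (b.orthonormal.1 i)⟩, ?_, fun x hx => ?_⟩
  · exact b.orthonormal.comp_linearIsometry V.subtypeₗᵢ
  · have := congrArg ((↑) : V → Euc d) (b.sum_repr' ⟨x, hx⟩)
    simp only [AddSubmonoidClass.coe_finsetSum, Submodule.coe_smul, Submodule.coe_inner] at this
    exact this.symm

end SphereConvolution

/-! ### Stationary chains of measures do not charge subspaces -/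

section Subspaces

variable {d : ℕ}

theorem subSph_bot : subSph (⊥ : Submodule ℝ (Euc d)) = ∅ := by
  ext x
  simp only [subSph, Set.mem_ofPred_eq, Submodule.mem_bot, Set.mem_empty_iff_false, iff_false]
  intro h
  have := x.2
  simp [h] at this

theorem subSph_inf (V W : Submodule ℝ (Euc d)) : subSph (V ⊓ W) = subSph V ∩ subSph W := rfl

theorem exists_chain_maximizing_measure_subSph {K : Set (ProbabilityMeasure (SL d))}
    (hK : IsCompact K) {r : ℕ}
    (h : ∃ p ∈ chainsUpTo K ⊤, ∃ V : Submodule ℝ (Euc d), Module.finrank ℝ V = r ∧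
      (p.2 0 : Measure (Sph d)) (subSph V) ≠ 0) :
    ∃ p ∈ chainsUpTo K ⊤, ∃ V : Submodule ℝ (Euc d), Module.finrank ℝ V = r ∧
      (p.2 0 : Measure (Sph d)) (subSph V) ≠ 0 ∧
      ∀ q ∈ chainsUpTo K ⊤, ∀ W : Submodule ℝ (Euc d), Module.finrank ℝ W = r →
        (q.2 0 : Measure (Sph d)) (subSph W) ≤ (p.2 0 : Measure (Sph d)) (subSph V) := by
  let Z : Set (((ℕ → ProbabilityMeasure (SL d)) × (ℕ → ProbabilityMeasure (Sph d))) ×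
      (Fin r → Sph d)) :=
    chainsUpTo K ⊤ ×ˢ {y : Fin r → Sph d | Orthonormal ℝ fun i => (y i : Euc d)}
  have hZ : IsCompact Z :=
    (isCompact_chainsUpTo hK ⊤).prod (isClosed_setOf_orthonormal d r).isCompact
  let g : ((ℕ → ProbabilityMeasure (SL d)) × (ℕ → ProbabilityMeasure (Sph d))) ×
      (Fin r → Sph d) → ℝ≥0∞ := fun z =>
    (z.1.2 0 : Measure (Sph d)) {x | (z.2, x) ∈ frameSet d r}
  have hg : UpperSemicontinuous g := by
    have hc : Continuous fun z : ((ℕ → ProbabilityMeasure (SL d)) ×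
        (ℕ → ProbabilityMeasure (Sph d))) × (Fin r → Sph d) => (z.1.2 0, z.2) := by fun_prop
    exact UpperSemicontinuous.comp
      (upperSemicontinuous_measure_section (isClosed_frameSet d r)) hc
  have key : ∀ q ∈ chainsUpTo K ⊤, ∀ W : Submodule ℝ (Euc d), Module.finrank ℝ W = r →
      ∃ y, (q, y) ∈ Z ∧ (q.2 0 : Measure (Sph d)) (subSph W) ≤ g (q, y) := by
    rintro q hq W rfl
    obtain ⟨y, hy, hy'⟩ := exists_orthonormal_frame W
    exact ⟨y, ⟨hq, hy⟩, measure_mono hy'⟩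
  obtain ⟨p, hp, V, hV, hpV⟩ := h
  obtain ⟨y, hy, hy'⟩ := key p hp V hV
  obtain ⟨⟨p', y'⟩, hp', hmax⟩ := UpperSemicontinuousOn.exists_isMaxOn ⟨_, hy⟩ hZ
    (hg.upperSemicontinuousOn Z)
  have hle : g (p', y') ≤
      (p'.2 0 : Measure (Sph d)) (subSph (Submodule.span ℝ (Set.range fun i => (y' i : Euc d)))) := by
    refine measure_mono fun x hx => ?_
    have hx' : (x : Euc d) = ∑ i, ⟪(y' i : Euc d), (x : Euc d)⟫ • (y' i : Euc d) := hx
    change (x : Euc d) ∈ Submodule.span ℝ (Set.range fun i => (y' i : Euc d))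
    rw [hx']
    exact Submodule.sum_mem _ fun i _ => Submodule.smul_mem _ _ (Submodule.subset_span ⟨i, rfl⟩)
  refine ⟨p', hp'.1, Submodule.span ℝ (Set.range fun i => (y' i : Euc d)), ?_, ?_, ?_⟩
  · simpa using finrank_span_eq_card (hp'.2 : Orthonormal ℝ fun i => (y' i : Euc d)).linearIndependent
  · have h1 : g (p, y) ≤ g (p', y') := hmax hy
    exact (lt_of_lt_of_le (pos_iff_ne_zero.2 hpV) (hy'.trans (h1.trans hle))).ne'
  · intro q hq W hW
    obtain ⟨z, hz, hz'⟩ := key q hq W hW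
    have h1 : g (q, z) ≤ g (p', y') := hmax hz
    exact hz'.trans (h1.trans hle)

theorem card_mul_le_one_of_measure_subSph_eq (ν : ProbabilityMeasure (Sph d)) {r : ℕ}
    (hnull : ∀ V : Submodule ℝ (Euc d), Module.finrank ℝ V < r →
      (ν : Measure (Sph d)) (subSph V) = 0)
    {M : ℝ≥0∞} (F : Finset (Submodule ℝ (Euc d)))
    (hF : ∀ V ∈ F, Module.finrank ℝ V = r ∧ (ν : Measure (Sph d)) (subSph V) = M) :
    F.card * M ≤ 1 := by
  have h : (ν : Measure (Sph d)) (⋃ V ∈ F, subSph V) =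
      ∑ V ∈ F, (ν : Measure (Sph d)) (subSph V) := by
    refine measure_biUnion_finset₀ ?_ fun V _ => (measurableSet_subSph V).nullMeasurableSet
    intro V hV W hW hVW
    change (ν : Measure (Sph d)) (subSph V ∩ subSph W) = 0
    rw [← subSph_inf]
    apply hnull
    have h1 := (hF V hV).1
    have h2 := (hF W hW).1
    by_contra hlt
    have h3 : V ⊓ W = V := Submodule.eq_of_le_of_finrank_le inf_le_left (by omega)
    have h4 : V ⊓ W = W := Submodule.eq_of_le_of_finrank_le inf_le_right (by omega)
    exact hVW (h3.symm.trans h4)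
  rw [Finset.sum_congr rfl fun V hV => (hF V hV).2, Finset.sum_const, nsmul_eq_mul] at h
  rw [← h]
  exact prob_le_one

/-- If the linear parts of finite families of subspaces are almost surely permuted into each other
then the spaces condition fails. -/
theorem not_spacesCondition_of_image_comap_eq {μ : ProbabilityMeasure (SL d)}
    {S S' : Set (Submodule ℝ (Euc d))} (hS : S.Finite) (hS' : S.Nonempty)
    (hproper : ∀ V ∈ S, V ≠ ⊥ ∧ V ≠ ⊤)
    (h : ∀ᵐ A ∂(μ : Measure (SL d)),
      (fun V : Submodule ℝ (Euc d) => V.comap (slEquiv A : Euc d →ₗ[ℝ] Euc d)) '' S = S') :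
    ¬ SpacesCondition μ := by
  obtain ⟨A₀, hA₀⟩ := h.exists
  let e : Euc d ≃ₗ[ℝ] (Fin d → ℝ) := WithLp.linearEquiv 2 ℝ (Fin d → ℝ)
  have hunion : ∀ R : Set (Submodule ℝ (Euc d)), R.Finite → R.Nonempty →
      (∀ V ∈ R, V ≠ ⊥ ∧ V ≠ ⊤) → IsFiniteUnionOfProperSubspaces
        (⋃ V ∈ R, e '' (V : Set (Euc d))) := by
    intro R h1 h2 h3
    refine ⟨(Submodule.map (e : Euc d →ₗ[ℝ] (Fin d → ℝ))) '' R, h1.image _, h2.image _, ?_, ?_⟩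
    · rintro _ ⟨V, hV, rfl⟩
      refine ⟨fun h => (h3 V hV).1 ?_, fun h => (h3 V hV).2 ?_⟩
      · exact Submodule.map_eq_bot_iff.1 h
      · exact (Submodule.map_eq_top_iff (e := e)).1 h
    · rw [Set.biUnion_image]
      rfl
  intro hsp
  refine hsp ⟨⋃ V ∈ S', e '' (V : Set (Euc d)), ⋃ V ∈ S, e '' (V : Set (Euc d)),
    hunion S' ?_ ?_ ?_, hunion S hS hS' hproper, ?_⟩
  · exact hA₀ ▸ hS.image _
  · exact hA₀ ▸ hS'.image _
  · rw [← hA₀]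
    rintro _ ⟨V, hV, rfl⟩
    have h0 : Submodule.comap (slEquiv A₀ : Euc d →ₗ[ℝ] Euc d) ⊥ = ⊥ := by
      simp
    refine ⟨fun h => (hproper V hV).1 ?_, fun h => (hproper V hV).2 ?_⟩
    · exact comap_slEquiv_injective A₀ (h.trans h0.symm)
    · exact comap_slEquiv_injective A₀ (h.trans (Submodule.comap_top _).symm)
  · filter_upwards [h] with A hA
    rw [← hA, Set.biUnion_image, Set.image_iUnion₂]
    refine Set.iUnion₂_congr fun V _ => ?_
    rw [← Set.image_comp]
    ext w
    constructor
    · rintro ⟨v, hv, rfl⟩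
      exact ⟨slVec A v, hv, rfl⟩
    · rintro ⟨v, hv, rfl⟩
      refine ⟨slVec A⁻¹ v, ?_, ?_⟩
      · change slVec A (slVec A⁻¹ v) ∈ V
        rwa [slVec_slVec_inv]
      · change e (slVec A (slVec A⁻¹ v)) = e v
        rw [slVec_slVec_inv]

theorem chain_measure_subSph_eq_zero {K : Set (ProbabilityMeasure (SL d))} (hK : IsCompact K)
    (hsp : ∀ μ ∈ K, SpacesCondition μ) (r : ℕ) (hr : r < d) :
    ∀ p ∈ chainsUpTo K ⊤, ∀ V : Submodule ℝ (Euc d), Module.finrank ℝ V = r →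
      (p.2 0 : Measure (Sph d)) (subSph V) = 0 := by
  induction r using Nat.strong_induction_on with
  | _ r ih =>
  by_contra! hcon
  obtain ⟨p, hp, V₀, hV₀, hM, hmax⟩ := exists_chain_maximizing_measure_subSph hK hcon
  set M := (p.2 0 : Measure (Sph d)) (subSph V₀) with hMdef
  have hmax' : ∀ j (W : Submodule ℝ (Euc d)), Module.finrank ℝ W = r →
      (p.2 j : Measure (Sph d)) (subSph W) ≤ M := fun j W hW => by
    simpa using hmax _ (shift_mem_chainsUpTo hp j) W hW
  have hnull : ∀ j (W : Submodule ℝ (Euc d)), Module.finrank ℝ W < r →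
      (p.2 j : Measure (Sph d)) (subSph W) = 0 := fun j W hW => by
    simpa using ih _ hW (hW.trans hr) _ (shift_mem_chainsUpTo hp j) W rfl
  let S : ℕ → Set (Submodule ℝ (Euc d)) := fun j =>
    {V | Module.finrank ℝ V = r ∧ (p.2 j : Measure (Sph d)) (subSph V) = M}
  obtain ⟨N, hN⟩ : ∃ N : ℕ, 1 < N * M := ENNReal.exists_nat_mul_gt hM ENNReal.one_ne_top
  have hcard : ∀ j (F : Finset (Submodule ℝ (Euc d))), (F : Set _) ⊆ S j → F.card < N := by
    intro j F hF
    have h1 := card_mul_le_one_of_measure_subSph_eq (p.2 j) (hnull j) F fun V hV => hF hV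
    by_contra! hge
    exact (hN.trans_le ((mul_le_mul_left (Nat.cast_le.2 hge) _).trans h1)).false
  have hfin : ∀ j, (S j).Finite := by
    intro j
    by_contra hinf
    obtain ⟨F, hF, hFc⟩ := Set.Infinite.exists_subset_card_eq hinf N
    exact (hcard j F hF).ne hFc
  have hlt : ∀ j, (S j).ncard < N := by
    intro j
    rw [Set.ncard_eq_toFinset_card _ (hfin j)]
    exact hcard j _ (by simp)
  have hae : ∀ j, ∀ᵐ A ∂(p.1 j : Measure (SL d)),
      (fun V : Submodule ℝ (Euc d) => V.comap (slEquiv A : Euc d →ₗ[ℝ] Euc d)) '' S j ⊆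
        S (j + 1) := by
    intro j
    have h1 : ∀ V ∈ S j, ∀ᵐ A ∂(p.1 j : Measure (SL d)),
        (p.2 (j + 1) : Measure (Sph d)) (sphMap A ⁻¹' subSph V) = M := by
      intro V hV
      have h2 : ∫⁻ A, (p.2 (j + 1) : Measure (Sph d)) (sphMap A ⁻¹' subSph V)
          ∂(p.1 j : Measure (SL d)) = M := by
        rw [← sphConv_apply _ _ (measurableSet_subSph V), ← hp.2 j (ENat.natCast_lt_top _)]
        exact hV.2
      refine ae_eq_of_ae_le_of_lintegral_le (g := fun _ => M) (ae_of_all _ fun A => ?_) ?_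
        aemeasurable_const ?_
      · beta_reduce
        rw [preimage_subSph]
        exact hmax' _ _ ((finrank_comap_slEquiv A V).trans hV.1)
      · rw [h2]
        exact (measure_lt_top _ _).ne
      · rw [h2]
        simp
    filter_upwards [(ae_ball_iff (hfin j).countable).2 h1] with A hA
    rintro _ ⟨V, hV, rfl⟩
    refine ⟨(finrank_comap_slEquiv A V).trans hV.1, ?_⟩
    rw [← preimage_subSph]
    exact hA V hV
  have hmono : ∀ j, (S j).ncard ≤ (S (j + 1)).ncard := by
    intro j
    obtain ⟨A, hA⟩ := (hae j).exists
    rw [← Set.ncard_image_of_injective (S j) (comap_slEquiv_injective A)]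
    exact Set.ncard_le_ncard hA (hfin _)
  obtain ⟨j, hj⟩ : ∃ j, (S (j + 1)).ncard ≤ (S j).ncard := by
    by_contra! hstrict
    have := (strictMono_nat_of_lt_succ hstrict).id_le N
    exact (hlt N).not_ge this
  have hne : (S j).Nonempty := by
    have h1 : 0 < (S 0).ncard := (Set.ncard_pos (hfin 0)).2 ⟨V₀, hV₀, rfl⟩
    exact (Set.ncard_pos (hfin j)).1
      (h1.trans_le (monotone_nat_of_le_succ hmono (Nat.zero_le j)))
  refine not_spacesCondition_of_image_comap_eq (μ := p.1 j) (S' := S (j + 1)) (hfin j) hne ?_ ?_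
    (hsp _ (hp.1 j))
  · intro V hV
    refine ⟨?_, ?_⟩
    · rintro rfl
      apply hM
      rw [← hV.2, subSph_bot, measure_empty]
    · rintro rfl
      have := hV.1
      simp at this
      omega
  · filter_upwards [hae j] with A hA
    refine Set.eq_of_subset_of_ncard_le hA ?_ (hfin _)
    rwa [Set.ncard_image_of_injective (S j) (comap_slEquiv_injective A)]

end Subspaces

/-! ### Random images of a vector are rarely close to a hyperplane -/

section Hyperplanes

variable {d : ℕ}

theorem measurable_sphMap_left (u : Sph d) : Measurable fun A : SL d => sphMap A u :=
  (continuous_sphMap.comp (Continuous.prodMk_left u)).measurable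

/-- `convLaw` as a bundled probability measure. -/
def convProb (μ : ℕ → ProbabilityMeasure (SL d)) (n : ℕ) : ProbabilityMeasure (SL d) :=
  ⟨convLaw μ n, inferInstance⟩

/-- The law of the image of `u` under a random product of `n` matrices. -/
def orbitLaw (μ : ℕ → ProbabilityMeasure (SL d)) (u : Sph d) (n : ℕ) :
    ProbabilityMeasure (Sph d) :=
  (convProb μ n).map (f := fun A => sphMap A u)
    (measurable_sphMap_left u).aemeasurable

theorem orbitLaw_apply (μ : ℕ → ProbabilityMeasure (SL d)) (u : Sph d) (n : ℕ)
    {s : Set (Sph d)} (hs : MeasurableSet s) :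
    (orbitLaw μ u n : Measure (Sph d)) s = convLaw μ n {A | sphMap A u ∈ s} := by
  exact Measure.map_apply (measurable_sphMap_left u) hs

theorem orbitLaw_succ (μ : ℕ → ProbabilityMeasure (SL d)) (u : Sph d) (n : ℕ) :
    orbitLaw μ u (n + 1) = sphConv (μ n) (orbitLaw μ u n) := by
  apply Subtype.ext
  ext s hs
  have hm : MeasurableSet {A : SL d | sphMap A u ∈ s} := measurable_sphMap_left u hs
  change (orbitLaw μ u (n + 1) : Measure (Sph d)) s = (sphConv (μ n) (orbitLaw μ u n) :
    Measure (Sph d)) s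
  rw [orbitLaw_apply _ _ _ hs, sphConv_apply _ _ hs, convLaw, Measure.mconv,
    Measure.map_apply measurable_mul hm, Measure.prod_apply (measurable_mul hm)]
  refine lintegral_congr fun A => ?_
  rw [orbitLaw_apply _ _ _ (measurable_sphMap A hs)]
  congr 1
  ext B
  simp [sphMap_mul]

theorem orbitLaw_mem_chainsUpTo {K : Set (ProbabilityMeasure (SL d))}
    {μ : ℕ → ProbabilityMeasure (SL d)} (hμ : ∀ i, μ i ∈ K) (u : Sph d) (m : ℕ) :
    ((fun j => μ (m - 1 - j), fun j => orbitLaw μ u (m - j)) :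
      (ℕ → ProbabilityMeasure (SL d)) × (ℕ → ProbabilityMeasure (Sph d))) ∈ chainsUpTo K m := by
  refine ⟨fun j => hμ _, fun j hj => ?_⟩
  have hj' : j < m := by exact_mod_cast hj
  have h : m - j = (m - 1 - j) + 1 := by omega
  have h' : m - (j + 1) = m - 1 - j := by omega
  simp only [h, h']
  exact orbitLaw_succ _ _ _

theorem chainsUpTo_anti (K : Set (ProbabilityMeasure (SL d))) {m m' : ℕ∞} (h : m ≤ m') :
    chainsUpTo K m' ⊆ chainsUpTo K m :=
  fun _ hp => ⟨hp.1, fun j hj => hp.2 j (hj.trans_le h)⟩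

theorem exists_uniform_measure_near_hyperplane_le {K : Set (ProbabilityMeasure (SL d))}
    (hK : IsCompact K) (hsp : ∀ μ ∈ K, SpacesCondition μ) {ε : ℝ≥0∞} (hε : ε ≠ 0) :
    ∃ (m : ℕ) (δ : ℝ), 0 < δ ∧ ∀ μ : ℕ → ProbabilityMeasure (SL d), (∀ i, μ i ∈ K) →
      ∀ u w : Sph d, convLaw μ m {A | |⟪(w : Euc d), (sphMap A u : Euc d)⟫| ≤ δ} ≤ ε := by
  by_contra! hcon
  let F : ℕ → Set (Sph d × Sph d) := fun m =>
    {q | |⟪(q.1 : Euc d), (q.2 : Euc d)⟫| ≤ 1 / ((m : ℝ) + 1)}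
  have hF : ∀ m, IsClosed (F m) := fun m => isClosed_le (by fun_prop) continuous_const
  have hFanti : Antitone F := by
    intro a b hab q hq
    exact le_trans (α := ℝ) hq (Nat.one_div_le_one_div hab)
  let c : ℕ → Set (((ℕ → ProbabilityMeasure (SL d)) × (ℕ → ProbabilityMeasure (Sph d))) ×
      Sph d) := fun m =>
    (chainsUpTo K m ×ˢ Set.univ) ∩
      {z | ε ≤ (z.1.2 0 : Measure (Sph d)) {x | (z.2, x) ∈ F m}}
  have hcomp : ∀ m, IsCompact (c m) := by
    intro m
    refine ((isCompact_chainsUpTo hK m).prod isCompact_univ).inter_right ?_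
    have hc : Continuous fun z : ((ℕ → ProbabilityMeasure (SL d)) ×
        (ℕ → ProbabilityMeasure (Sph d))) × Sph d => (z.1.2 0, z.2) := by fun_prop
    exact UpperSemicontinuous.isClosed_preimage
      (UpperSemicontinuous.comp (upperSemicontinuous_measure_section (hF m)) hc) ε
  have hcanti : ∀ m, c (m + 1) ⊆ c m := by
    intro m z hz
    have h1 : ε ≤ (z.1.2 0 : Measure (Sph d)) {x | (z.2, x) ∈ F (m + 1)} := hz.2
    have h2 : {x | (z.2, x) ∈ F (m + 1)} ⊆ {x | (z.2, x) ∈ F m} :=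
      fun x hx => hFanti m.le_succ hx
    exact ⟨⟨chainsUpTo_anti K (Nat.cast_le.2 m.le_succ) hz.1.1, trivial⟩,
      h1.trans (measure_mono h2)⟩
  obtain ⟨⟨p, w⟩, hpw⟩ := IsCompact.nonempty_iInter_of_sequence_nonempty_isCompact_isClosed c
    hcanti
    (fun m => by
      obtain ⟨μ, hμ, u, w, h⟩ := hcon m (1 / ((m : ℝ) + 1)) Nat.one_div_pos_of_nat
      refine ⟨(_, w), ⟨orbitLaw_mem_chainsUpTo hμ u m, trivial⟩, ?_⟩
      have hmeas : MeasurableSet {x | (w, x) ∈ F m} :=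
        measurable_prodMk_left (hF m).measurableSet
      change ε ≤ (orbitLaw μ u (m - 0) : Measure (Sph d)) {x | (w, x) ∈ F m}
      rw [orbitLaw_apply _ _ _ hmeas]
      exact h.le) (hcomp 0) fun m => (hcomp m).isClosed
  rw [Set.mem_iInter] at hpw
  have hp : p ∈ chainsUpTo K ⊤ := by
    refine ⟨(hpw 0).1.1.1, fun j _ => (hpw (j + 1)).1.1.2 j ?_⟩
    exact_mod_cast j.lt_succ_self
  have hlim := tendsto_measure_iInter_atTop (μ := (p.2 0 : Measure (Sph d)))
    (s := fun m => {x | (w, x) ∈ F m})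
    (fun m => (measurable_prodMk_left (hF m).measurableSet).nullMeasurableSet)
    (fun a b hab x hx => hFanti hab hx) ⟨0, measure_ne_top _ _⟩
  have hle := ge_of_tendsto' hlim fun m => (hpw m).2
  have hsub : (⋂ m, {x | (w, x) ∈ F m}) ⊆ subSph (ℝ ∙ (w : Euc d))ᗮ := by
    intro x hx
    rw [Set.mem_iInter] at hx
    change (x : Euc d) ∈ (ℝ ∙ (w : Euc d))ᗮ
    rw [Submodule.mem_orthogonal_singleton_iff_inner_right, ← abs_nonpos_iff]
    exact ge_of_tendsto' tendsto_one_div_add_atTop_nhds_zero_nat hx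
  have hzero := chain_measure_subSph_eq_zero hK hsp
    (Module.finrank ℝ (ℝ ∙ (w : Euc d))ᗮ) ?_ p hp _ rfl
  · exact hε (le_antisymm (hle.trans ((measure_mono hsub).trans hzero.le)) bot_le)
  · have h : (ℝ ∙ (w : Euc d))ᗮ ≠ ⊤ := by
      intro h
      have h1 : (w : Euc d) ∈ (ℝ ∙ (w : Euc d))ᗮ := h ▸ Submodule.mem_top
      rw [Submodule.mem_orthogonal_singleton_iff_inner_right, real_inner_self_eq_norm_sq] at h1
      simp at h1
    simpa using Submodule.finrank_lt h

end Hyperplanes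

/-! ### A random matrix moves every measure on the sphere -/

section Spread

variable {d : ℕ}

/-- The map induced by a matrix on the projective space is continuous. -/
theorem continuous_projMap (A : SL d) : Continuous (projMap A) := by
  have h : Continuous fun v : { v : Fin d → ℝ // v ≠ 0 } =>
      (⟨Matrix.toLin' (A : Matrix (Fin d) (Fin d) ℝ) v, fun h => v.2 (toLin'_injective A
        (h.trans (map_zero _).symm))⟩ : { v : Fin d → ℝ // v ≠ 0 }) := by
    refine Continuous.subtype_mk ?_ _
    exact (LinearMap.continuous_of_finiteDimensional _).comp continuous_subtype_val
  have hq := isQuotientMap_quotient_mk' (s := projectivizationSetoid ℝ (Fin d → ℝ))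
  exact hq.continuous_iff.2 (continuous_quotient_mk'.comp h)

theorem ofLp_ne_zero (x : Sph d) : (x : Euc d).ofLp ≠ 0 := by
  intro h
  have h1 : (x : Euc d) = 0 := by ext i; simp [h]
  have := x.2
  simp [h1] at this

/-- The projection from the sphere to the projective space. -/
def sphToProj (x : Sph d) : Proj d := Projectivization.mk ℝ (x : Euc d).ofLp (ofLp_ne_zero x)

theorem continuous_sphToProj : Continuous (sphToProj : Sph d → Proj d) := by
  have h : Continuous fun x : Sph d =>
      (⟨(x : Euc d).ofLp, ofLp_ne_zero x⟩ : { v : Fin d → ℝ // v ≠ 0 }) :=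
    Continuous.subtype_mk (by fun_prop) _
  exact continuous_quotient_mk'.comp h

theorem projMap_sphToProj (A : SL d) (x : Sph d) :
    projMap A (sphToProj x) = sphToProj (sphMap A x) := by
  rw [sphToProj, sphToProj, projMap, Projectivization.map_mk, Projectivization.mk_eq_mk_iff']
  refine ⟨‖slVec A x‖, ?_⟩
  have h := congrArg WithLp.ofLp (slVec_eq_smul_sphMap A x)
  simpa [slVec] using h.symm

theorem not_measuresCondition_of_map_sphMap_eq {μ : ProbabilityMeasure (SL d)}
    (ν₁ ν₂ : ProbabilityMeasure (Sph d))
    (h : ∀ᵐ A ∂(μ : Measure (SL d)),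
      (ν₁ : Measure (Sph d)).map (sphMap A) = (ν₂ : Measure (Sph d))) :
    ¬ MeasuresCondition μ := by
  have hm := (continuous_sphToProj (d := d)).measurable
  refine fun hcon => hcon ⟨ν₁.map hm.aemeasurable, ν₂.map hm.aemeasurable, ?_⟩
  filter_upwards [h] with A hA
  rw [ProbabilityMeasure.toMeasure_map, ProbabilityMeasure.toMeasure_map, ← hA,
    Measure.map_map (continuous_projMap A).measurable hm,
    Measure.map_map hm (measurable_sphMap A)]
  congr 1
  ext1 x
  exact projMap_sphToProj A x

/-- The mean square deviation of the integral of `φ` against the image of `ν` under a random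
matrix with law `μ`. -/
def spread (φ : C(Sph d, ℝ)) (μ : ProbabilityMeasure (SL d)) (ν : ProbabilityMeasure (Sph d)) :
    ℝ :=
  ∫ p : SL d × SL d, (∫ x, φ (sphMap p.1 x) ∂(ν : Measure (Sph d)) -
    ∫ x, φ (sphMap p.2 x) ∂(ν : Measure (Sph d))) ^ 2
      ∂((μ : Measure (SL d)).prod (μ : Measure (SL d)))

theorem integrable_comp_sphMap (φ : C(Sph d, ℝ)) (A : SL d) (ν : ProbabilityMeasure (Sph d)) :
    Integrable (fun x => φ (sphMap A x)) (ν : Measure (Sph d)) := by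
  refine Integrable.of_bound
    (φ.continuous.measurable.comp (measurable_sphMap A)).aestronglyMeasurable ‖φ‖ ?_
  exact ae_of_all _ fun x => φ.norm_coe_le_norm _

theorem continuous_comp_sphMap {X : Type*} [TopologicalSpace X] (φ : C(Sph d, ℝ)) {f : X → SL d}
    {g : X → Sph d} (hf : Continuous f) (hg : Continuous g) :
    Continuous fun q => φ (sphMap (f q) (g q)) := by
  have h : Continuous fun p : SL d × Sph d => φ (sphMap p.1 p.2) :=
    φ.continuous.comp continuous_sphMap
  exact Continuous.comp (f := fun q => (f q, g q)) h (hf.prodMk hg)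

theorem continuous_spread_integrand (φ : C(Sph d, ℝ)) :
    Continuous fun q : (SL d × SL d) × (Sph d × Sph d) =>
      (φ (sphMap q.1.1 q.2.1) - φ (sphMap q.1.2 q.2.1)) *
        (φ (sphMap q.1.1 q.2.2) - φ (sphMap q.1.2 q.2.2)) := by
  have h₁ : Continuous fun q : (SL d × SL d) × (Sph d × Sph d) => q.1.1 :=
    continuous_fst.comp continuous_fst
  have h₂ : Continuous fun q : (SL d × SL d) × (Sph d × Sph d) => q.1.2 :=
    continuous_snd.comp continuous_fst
  have h₃ : Continuous fun q : (SL d × SL d) × (Sph d × Sph d) => q.2.1 :=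
    continuous_fst.comp continuous_snd
  have h₄ : Continuous fun q : (SL d × SL d) × (Sph d × Sph d) => q.2.2 :=
    continuous_snd.comp continuous_snd
  exact ((continuous_comp_sphMap φ h₁ h₃).sub (continuous_comp_sphMap φ h₂ h₃)).mul
    ((continuous_comp_sphMap φ h₁ h₄).sub (continuous_comp_sphMap φ h₂ h₄))

theorem abs_sub_le_two_mul_norm (φ : C(Sph d, ℝ)) (x y : Sph d) :
    |φ x - φ y| ≤ ‖φ‖ + ‖φ‖ :=
  (abs_sub _ _).trans (add_le_add (φ.norm_coe_le_norm _) (φ.norm_coe_le_norm _))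

/-- The integrand of the spread as a bounded continuous function of all variables. -/
def spreadKernel (φ : C(Sph d, ℝ)) :
    BoundedContinuousFunction ((SL d × SL d) × (Sph d × Sph d)) ℝ :=
  BoundedContinuousFunction.ofNormedAddCommGroup _ (continuous_spread_integrand φ)
    ((‖φ‖ + ‖φ‖) * (‖φ‖ + ‖φ‖)) fun q => by
      rw [Real.norm_eq_abs, abs_mul]
      exact mul_le_mul (abs_sub_le_two_mul_norm φ _ _) (abs_sub_le_two_mul_norm φ _ _)
        (abs_nonneg _) (by positivity)

theorem spread_eq (φ : C(Sph d, ℝ)) (μ : ProbabilityMeasure (SL d))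
    (ν : ProbabilityMeasure (Sph d)) :
    spread φ μ ν = ∫ q, spreadKernel φ q ∂((μ.prod μ).prod (ν.prod ν) :
      Measure ((SL d × SL d) × (Sph d × Sph d))) := by
  rw [ProbabilityMeasure.toMeasure_prod, integral_prod _ ((spreadKernel φ).integrable _),
    ProbabilityMeasure.toMeasure_prod, ProbabilityMeasure.toMeasure_prod]
  refine integral_congr_ae (ae_of_all _ fun p => ?_)
  beta_reduce
  rw [← integral_sub (integrable_comp_sphMap φ p.1 ν) (integrable_comp_sphMap φ p.2 ν), pow_two]
  exact (integral_prod_mul (μ := (ν : Measure (Sph d))) (ν := (ν : Measure (Sph d))) _ _).symm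

theorem continuous_spread (φ : C(Sph d, ℝ)) :
    Continuous fun p : ProbabilityMeasure (SL d) × ProbabilityMeasure (Sph d) =>
      spread φ p.1 p.2 := by
  simp_rw [spread_eq]
  have h1 : Continuous fun p : ProbabilityMeasure (SL d) × ProbabilityMeasure (Sph d) =>
      p.1.prod p.1 :=
    ProbabilityMeasure.continuous_prod.comp (continuous_fst.prodMk continuous_fst)
  have h2 : Continuous fun p : ProbabilityMeasure (SL d) × ProbabilityMeasure (Sph d) =>
      p.2.prod p.2 :=
    ProbabilityMeasure.continuous_prod.comp (continuous_snd.prodMk continuous_snd)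
  exact (ProbabilityMeasure.continuous_integral_boundedContinuousFunction (spreadKernel φ)).comp
    (ProbabilityMeasure.continuous_prod.comp (h1.prodMk h2))

theorem measurable_integral_comp_sphMap (φ : C(Sph d, ℝ)) (ν : ProbabilityMeasure (Sph d)) :
    Measurable fun A : SL d => ∫ x, φ (sphMap A x) ∂(ν : Measure (Sph d)) := by
  have h : StronglyMeasurable fun p : SL d × Sph d => φ (sphMap p.1 p.2) :=
    (φ.continuous.comp continuous_sphMap).stronglyMeasurable
  exact h.integral_prod_right.measurable

theorem abs_integral_comp_sphMap_le (φ : C(Sph d, ℝ)) (A : SL d)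
    (ν : ProbabilityMeasure (Sph d)) :
    |∫ x, φ (sphMap A x) ∂(ν : Measure (Sph d))| ≤ ‖φ‖ := by
  have := norm_integral_le_of_norm_le_const (μ := (ν : Measure (Sph d))) (C := ‖φ‖)
    (f := fun x => φ (sphMap A x)) (ae_of_all _ fun x => φ.norm_coe_le_norm _)
  simpa using this

theorem integrable_spread (φ : C(Sph d, ℝ)) (μ : ProbabilityMeasure (SL d))
    (ν : ProbabilityMeasure (Sph d)) :
    Integrable (fun p : SL d × SL d => (∫ x, φ (sphMap p.1 x) ∂(ν : Measure (Sph d)) -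
      ∫ x, φ (sphMap p.2 x) ∂(ν : Measure (Sph d))) ^ 2)
        ((μ : Measure (SL d)).prod (μ : Measure (SL d))) := by
  have hm := measurable_integral_comp_sphMap φ ν
  refine Integrable.of_bound (((hm.comp measurable_fst).sub
    (hm.comp measurable_snd)).pow_const 2).aestronglyMeasurable ((‖φ‖ + ‖φ‖) ^ 2)
    (ae_of_all _ fun p => ?_)
  rw [Real.norm_eq_abs, abs_pow]
  gcongr
  exact (abs_sub _ _).trans
    (add_le_add (abs_integral_comp_sphMap_le _ _ _) (abs_integral_comp_sphMap_le _ _ _))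

theorem not_measuresCondition_of_spread_eq_zero {μ : ProbabilityMeasure (SL d)}
    {ν : ProbabilityMeasure (Sph d)} (h : ∀ φ, spread φ μ ν = 0) : ¬ MeasuresCondition μ := by
  let φ := TopologicalSpace.denseSeq C(Sph d, ℝ)
  have hae : ∀ᵐ p : SL d × SL d ∂((μ : Measure (SL d)).prod (μ : Measure (SL d))), ∀ n,
      ∫ x, φ n (sphMap p.1 x) ∂(ν : Measure (Sph d)) =
        ∫ x, φ n (sphMap p.2 x) ∂(ν : Measure (Sph d)) := by
    rw [ae_all_iff]
    intro n
    have h1 := (integral_eq_zero_iff_of_nonneg (fun _ => sq_nonneg _)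
      (integrable_spread (φ n) μ ν)).1 (h (φ n))
    filter_upwards [h1] with p hp
    simpa [sub_eq_zero] using hp
  have hmap : ∀ A B : SL d, (∀ n, ∫ x, φ n (sphMap A x) ∂(ν : Measure (Sph d)) =
      ∫ x, φ n (sphMap B x) ∂(ν : Measure (Sph d))) →
      (ν : Measure (Sph d)).map (sphMap B) = (ν : Measure (Sph d)).map (sphMap A) := by
    intro A B hAB
    have hA : Measurable (sphMap A) := measurable_sphMap A
    have hB : Measurable (sphMap B) := measurable_sphMap B
    have : IsProbabilityMeasure ((ν : Measure (Sph d)).map (sphMap A)) :=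
      Measure.isProbabilityMeasure_map hA.aemeasurable
    have : IsProbabilityMeasure ((ν : Measure (Sph d)).map (sphMap B)) :=
      Measure.isProbabilityMeasure_map hB.aemeasurable
    have hcont : ∀ A : SL d, Continuous fun ψ : C(Sph d, ℝ) =>
        ∫ x, ψ (sphMap A x) ∂(ν : Measure (Sph d)) := by
      intro A
      refine (LipschitzWith.of_dist_le_mul (K := 1) fun ψ ψ' => ?_).continuous
      rw [Real.dist_eq, ← integral_sub (integrable_comp_sphMap _ _ _)
        (integrable_comp_sphMap _ _ _), dist_eq_norm, NNReal.coe_one, one_mul]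
      exact abs_integral_comp_sphMap_le (ψ - ψ') A ν
    have hall : ∀ ψ : C(Sph d, ℝ), ∫ x, ψ (sphMap A x) ∂(ν : Measure (Sph d)) =
        ∫ x, ψ (sphMap B x) ∂(ν : Measure (Sph d)) := by
      have := Continuous.ext_on (TopologicalSpace.denseRange_denseSeq C(Sph d, ℝ))
        (hcont A) (hcont B) (by rintro _ ⟨n, rfl⟩; exact hAB n)
      exact congrFun this
    refine ext_of_forall_integral_eq_of_IsFiniteMeasure fun f => ?_
    rw [integral_map hB.aemeasurable f.continuous.measurable.aestronglyMeasurable,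
      integral_map hA.aemeasurable f.continuous.measurable.aestronglyMeasurable]
    exact (hall f.toContinuousMap).symm
  obtain ⟨A, hA⟩ := (Measure.ae_ae_of_ae_prod hae).exists
  refine not_measuresCondition_of_map_sphMap_eq ν (ν.map (measurable_sphMap A).aemeasurable) ?_
  filter_upwards [hA] with B hB
  exact hmap A B hB

theorem exists_lt_spread {K : Set (ProbabilityMeasure (SL d))} (hK : IsCompact K)
    (hmeas : ∀ μ ∈ K, MeasuresCondition μ) :
    ∃ κ : ℝ, 0 < κ ∧ ∀ μ ∈ K, ∀ ν, ∃ φ : C(Sph d, ℝ), κ * ‖φ‖ ^ 2 < spread φ μ ν := by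
  by_contra! hcon
  let D : ℕ → Set (ProbabilityMeasure (SL d) × ProbabilityMeasure (Sph d)) := fun n =>
    (K ×ˢ Set.univ) ∩ ⋂ φ : C(Sph d, ℝ), {p | spread φ p.1 p.2 ≤ 1 / ((n : ℝ) + 1) * ‖φ‖ ^ 2}
  have hD : ∀ n, IsCompact (D n) := fun n =>
    (hK.prod isCompact_univ).inter_right
      (isClosed_iInter fun φ => isClosed_le (continuous_spread φ) continuous_const)
  have hmem : ∀ n p, p ∈ D n ↔ p.1 ∈ K ∧ ∀ φ, spread φ p.1 p.2 ≤ 1 / ((n : ℝ) + 1) * ‖φ‖ ^ 2 := by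
    intro n p
    simp [D]
  have hanti : ∀ n, D (n + 1) ⊆ D n := by
    intro n p hp
    rw [hmem] at hp ⊢
    refine ⟨hp.1, fun φ => (hp.2 φ).trans ?_⟩
    gcongr
    simp
  obtain ⟨p, hp⟩ := IsCompact.nonempty_iInter_of_sequence_nonempty_isCompact_isClosed D hanti
    (fun n => by
      obtain ⟨μ, hμ, ν, h⟩ := hcon (1 / ((n : ℝ) + 1)) Nat.one_div_pos_of_nat
      exact ⟨(μ, ν), (hmem n _).2 ⟨hμ, h⟩⟩) (hD 0) fun n => (hD n).isClosed
  rw [Set.mem_iInter] at hp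
  simp only [hmem] at hp
  refine not_measuresCondition_of_spread_eq_zero (ν := p.2) (fun φ => ?_) (hmeas p.1 (hp 0).1)
  refine le_antisymm ?_ (integral_nonneg fun _ => sq_nonneg _)
  have hlim := (tendsto_one_div_add_atTop_nhds_zero_nat (𝕜 := ℝ)).mul_const (‖φ‖ ^ 2)
  rw [zero_mul] at hlim
  exact ge_of_tendsto' hlim fun n => (hp n).2 φ

end Spread

/-! ### Contraction of the averaging operator on square integrable functions -/

section Contraction

variable {d : ℕ}

theorem sq_integral_mul_le {X : Type*} [MeasurableSpace X] {m : Measure X} {g h : X → ℝ}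
    (hg : Integrable (fun x => g x ^ 2) m) (hh : Integrable (fun x => h x ^ 2) m)
    (hgh : Integrable (fun x => g x * h x) m) :
    (∫ x, g x * h x ∂m) ^ 2 ≤ (∫ x, g x ^ 2 ∂m) * ∫ x, h x ^ 2 ∂m := by
  have key : ∀ t : ℝ, 0 ≤ (∫ x, g x ^ 2 ∂m) * (t * t) + (2 * ∫ x, g x * h x ∂m) * t +
      ∫ x, h x ^ 2 ∂m := by
    intro t
    have h0 : 0 ≤ ∫ x, (t * g x + h x) ^ 2 ∂m := integral_nonneg fun _ => sq_nonneg _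
    have h1 : ∀ x, (t * g x + h x) ^ 2 = (t * t) * g x ^ 2 + (2 * t) * (g x * h x) + h x ^ 2 :=
      fun x => by ring
    simp_rw [h1] at h0
    have e1 : Integrable (fun x => (t * t) * g x ^ 2 + (2 * t) * (g x * h x)) m :=
      (hg.const_mul _).add (hgh.const_mul _)
    rw [integral_add e1 hh, integral_add (hg.const_mul _) (hgh.const_mul _), integral_const_mul,
      integral_const_mul] at h0
    linarith
  have := discrim_le_zero key
  rw [discrim] at this
  nlinarith

theorem measurePreserving_slVec (A : SL d) :
    MeasurePreserving (slVec A) (volume : Measure (Euc d)) volume := by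
  refine ⟨(slCLM A).continuous.measurable, ?_⟩
  have h := Measure.map_linearMap_addHaar_eq_smul_addHaar (volume : Measure (Euc d))
    (f := (slCLM A : Euc d →ₗ[ℝ] Euc d)) (by rw [slCLM_det]; exact one_ne_zero)
  rw [slCLM_det] at h
  simp only [inv_one, abs_one, ENNReal.ofReal_one, one_smul] at h
  exact h

theorem integral_comp_slVec (A : SL d) {g : Euc d → ℝ} (hg : Measurable g) :
    ∫ x, g (slVec A x) = ∫ x, g x := by
  have h := measurePreserving_slVec A
  conv_rhs => rw [← h.map_eq]
  rw [integral_map h.measurable.aemeasurable hg.aestronglyMeasurable]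

/-- Measurable integrable functions with values in the unit interval. -/
structure IsTestFunction (f : Euc d → ℝ) : Prop where
  measurable : Measurable f
  nonneg : ∀ x, 0 ≤ f x
  le_one : ∀ x, f x ≤ 1
  integrable : Integrable f

theorem IsTestFunction.comp_slVec {f : Euc d → ℝ} (hf : IsTestFunction f) (A : SL d) :
    IsTestFunction fun x => f (slVec A x) where
  measurable := hf.measurable.comp (slCLM A).continuous.measurable
  nonneg _ := hf.nonneg _
  le_one _ := hf.le_one _
  integrable := (measurePreserving_slVec A).integrable_comp_of_integrable hf.integrable

theorem IsTestFunction.integrable_mul {f g : Euc d → ℝ} (hf : IsTestFunction f)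
    (hg : IsTestFunction g) : Integrable fun x => f x * g x := by
  refine hf.integrable.mono' (hf.measurable.mul hg.measurable).aestronglyMeasurable
    (ae_of_all _ fun x => ?_)
  rw [Real.norm_eq_abs, abs_of_nonneg (mul_nonneg (hf.nonneg x) (hg.nonneg x))]
  exact mul_le_of_le_one_right (hf.nonneg x) (hg.le_one x)

theorem IsTestFunction.integrable_sq {f : Euc d → ℝ} (hf : IsTestFunction f) :
    Integrable fun x => f x ^ 2 := by
  simpa only [pow_two] using hf.integrable_mul hf

theorem IsTestFunction.integral_mul_le {f g : Euc d → ℝ} (hf : IsTestFunction f)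
    (hg : IsTestFunction g) : ∫ x, f x * g x ≤ ∫ x, f x :=
  integral_mono (hf.integrable_mul hg) hf.integrable fun x =>
    mul_le_of_le_one_right (hf.nonneg x) (hg.le_one x)

theorem measurable_slVec_inv_uncurry :
    Measurable fun p : SL d × Euc d => (slVec p.1⁻¹ p.2 : Euc d) :=
  (Continuous.slVec_apply (continuous_inv.comp continuous_fst) continuous_snd).measurable

/-- The average of the translates of `f` by a random matrix with law `μ`. -/
def translateMean (μ : Measure (SL d)) (f : Euc d → ℝ) (x : Euc d) : ℝ :=
  ∫ A, f (slVec A⁻¹ x) ∂μ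

theorem IsTestFunction.measurable_uncurry {f : Euc d → ℝ} (hf : IsTestFunction f) :
    Measurable fun p : SL d × Euc d => f (slVec p.1⁻¹ p.2) :=
  hf.measurable.comp measurable_slVec_inv_uncurry

theorem IsTestFunction.integrable_left {f : Euc d → ℝ} (hf : IsTestFunction f)
    (μ : Measure (SL d)) [IsProbabilityMeasure μ] (x : Euc d) :
    Integrable (fun A => f (slVec A⁻¹ x)) μ := by
  refine Integrable.of_bound
    (hf.measurable_uncurry.comp measurable_prodMk_right).aestronglyMeasurable 1
    (ae_of_all _ fun A => ?_)
  rw [Real.norm_eq_abs, abs_of_nonneg (hf.nonneg _)]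
  exact hf.le_one _

theorem IsTestFunction.integrable_uncurry {f : Euc d → ℝ} (hf : IsTestFunction f)
    (μ : Measure (SL d)) [IsProbabilityMeasure μ] :
    Integrable (fun p : SL d × Euc d => f (slVec p.1⁻¹ p.2)) (μ.prod volume) := by
  rw [integrable_prod_iff hf.measurable_uncurry.aestronglyMeasurable]
  refine ⟨ae_of_all _ fun A => (hf.comp_slVec A⁻¹).integrable, ?_⟩
  have h : ∀ A : SL d, ∫ x, ‖f (slVec A⁻¹ x)‖ = ∫ x, f x := by
    intro A
    simp_rw [Real.norm_eq_abs, abs_of_nonneg (hf.nonneg _)]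
    exact integral_comp_slVec A⁻¹ hf.measurable
  simp only [h]
  exact integrable_const _

theorem IsTestFunction.isTestFunction_translateMean {f : Euc d → ℝ} (hf : IsTestFunction f)
    (μ : Measure (SL d)) [IsProbabilityMeasure μ] : IsTestFunction (translateMean μ f) where
  measurable := hf.measurable_uncurry.stronglyMeasurable.integral_prod_left.measurable
  nonneg _ := integral_nonneg fun _ => hf.nonneg _
  le_one x := by
    have := integral_mono (hf.integrable_left μ x) (integrable_const 1) fun A => hf.le_one _
    simpa [translateMean] using this
  integrable := (hf.integrable_uncurry μ).integral_prod_right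

/-- The correlation of two translates of `f`. -/
def correlation (f : Euc d → ℝ) (p : SL d × SL d) : ℝ :=
  ∫ x, f (slVec p.1⁻¹ x) * f (slVec p.2⁻¹ x)

theorem IsTestFunction.correlation_le {f : Euc d → ℝ} (hf : IsTestFunction f)
    (p : SL d × SL d) : correlation f p ≤ ∫ x, f x ^ 2 := by
  have h1 := hf.comp_slVec p.1⁻¹
  have h2 := hf.comp_slVec p.2⁻¹
  have h : correlation f p ≤ ∫ x, (1 / 2 * f (slVec p.1⁻¹ x) ^ 2 + 1 / 2 * f (slVec p.2⁻¹ x) ^ 2) :=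
    integral_mono (h1.integrable_mul h2)
      ((h1.integrable_sq.const_mul _).add (h2.integrable_sq.const_mul _)) fun x => by
        nlinarith [sq_nonneg (f (slVec p.1⁻¹ x) - f (slVec p.2⁻¹ x))]
  rw [integral_add (h1.integrable_sq.const_mul _) (h2.integrable_sq.const_mul _),
    integral_const_mul, integral_const_mul,
    integral_comp_slVec p.1⁻¹ (hf.measurable.pow_const 2),
    integral_comp_slVec p.2⁻¹ (hf.measurable.pow_const 2)] at h
  linarith

theorem integrable_correlation_integrand {f : Euc d → ℝ} (hf : IsTestFunction f)
    (μ : Measure (SL d)) [IsProbabilityMeasure μ] :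
    Integrable (fun q : (SL d × SL d) × Euc d => f (slVec q.1.1⁻¹ q.2) * f (slVec q.1.2⁻¹ q.2))
      ((μ.prod μ).prod volume) := by
  have h1 : Measurable fun q : (SL d × SL d) × Euc d => f (slVec q.1.1⁻¹ q.2) :=
    Measurable.comp (g := fun p : SL d × Euc d => f (slVec p.1⁻¹ p.2))
      (f := fun q : (SL d × SL d) × Euc d => (q.1.1, q.2)) hf.measurable_uncurry (by fun_prop)
  have h2 : Measurable fun q : (SL d × SL d) × Euc d => f (slVec q.1.2⁻¹ q.2) :=
    Measurable.comp (g := fun p : SL d × Euc d => f (slVec p.1⁻¹ p.2))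
      (f := fun q : (SL d × SL d) × Euc d => (q.1.2, q.2)) hf.measurable_uncurry (by fun_prop)
  have hm : Measurable fun q : (SL d × SL d) × Euc d =>
      f (slVec q.1.1⁻¹ q.2) * f (slVec q.1.2⁻¹ q.2) := h1.mul h2
  rw [integrable_prod_iff hm.aestronglyMeasurable]
  refine ⟨ae_of_all _ fun p => (hf.comp_slVec p.1⁻¹).integrable_mul (hf.comp_slVec p.2⁻¹), ?_⟩
  refine Integrable.of_bound hm.norm.stronglyMeasurable.integral_prod_right.aestronglyMeasurable
    (∫ x, f x) (ae_of_all _ fun p => ?_)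
  rw [Real.norm_eq_abs, abs_of_nonneg (integral_nonneg fun _ => norm_nonneg _)]
  simp_rw [Real.norm_eq_abs, abs_of_nonneg (mul_nonneg (hf.nonneg _) (hf.nonneg _))]
  refine ((hf.comp_slVec p.1⁻¹).integral_mul_le (hf.comp_slVec p.2⁻¹)).trans ?_
  exact (integral_comp_slVec _ hf.measurable).le

theorem integrable_correlation {f : Euc d → ℝ} (hf : IsTestFunction f)
    (μ : Measure (SL d)) [IsProbabilityMeasure μ] :
    Integrable (correlation f) (μ.prod μ) :=
  (integrable_correlation_integrand hf μ).integral_prod_left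

theorem integral_translateMean_sq {f : Euc d → ℝ} (hf : IsTestFunction f)
    (μ : Measure (SL d)) [IsProbabilityMeasure μ] :
    ∫ x, translateMean μ f x ^ 2 = ∫ p, correlation f p ∂(μ.prod μ) := by
  have h : ∀ x, translateMean μ f x ^ 2 =
      ∫ p : SL d × SL d, f (slVec p.1⁻¹ x) * f (slVec p.2⁻¹ x) ∂(μ.prod μ) := by
    intro x
    rw [pow_two]
    exact (integral_prod_mul (μ := μ) (ν := μ) (fun A => f (slVec A⁻¹ x))
      fun A => f (slVec A⁻¹ x)).symm
  simp_rw [h]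
  exact (integral_integral_swap (integrable_correlation_integrand hf μ)).symm

/-- An `L²` estimate for the difference of two densities in terms of the correlation of their
square roots. -/
theorem sq_integral_mul_sq_sub_le {g h ψ : Euc d → ℝ} (hg : IsTestFunction g)
    (hh : IsTestFunction h) (hψ : Measurable ψ) {c N : ℝ} (hc : ∀ x, |ψ x| ≤ c)
    (hgN : ∫ x, g x ^ 2 = N) (hhN : ∫ x, h x ^ 2 = N) :
    ((∫ x, ψ x * g x ^ 2) - ∫ x, ψ x * h x ^ 2) ^ 2 ≤ 8 * c ^ 2 * N * (N - ∫ x, g x * h x) := by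
  have hc0 : 0 ≤ c := (abs_nonneg _).trans (hc 0)
  have hgh := hg.integrable_mul hh
  have hint : ∀ {u : Euc d → ℝ}, Integrable u → Integrable fun x => ψ x * u x := by
    intro u hu
    exact hu.bdd_mul hψ.aestronglyMeasurable (ae_of_all _ hc)
  have hsub : Integrable fun x => (g x - h x) ^ 2 := by
    have : ∀ x, (g x - h x) ^ 2 = g x ^ 2 - 2 * (g x * h x) + h x ^ 2 := fun x => by ring
    simp_rw [this]
    exact (hg.integrable_sq.sub (hgh.const_mul 2)).add hh.integrable_sq
  have hsubI : ∫ x, (g x - h x) ^ 2 = 2 * (N - ∫ x, g x * h x) := by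
    have : ∀ x, (g x - h x) ^ 2 = g x ^ 2 - 2 * (g x * h x) + h x ^ 2 := fun x => by ring
    simp_rw [this]
    have e1 : Integrable fun x => g x ^ 2 - 2 * (g x * h x) :=
      hg.integrable_sq.sub (hgh.const_mul 2)
    rw [integral_add e1 hh.integrable_sq,
      integral_sub hg.integrable_sq (hgh.const_mul 2), integral_const_mul, hgN, hhN]
    ring
  have hadd : Integrable fun x => (ψ x * (g x + h x)) ^ 2 := by
    have : ∀ x, (ψ x * (g x + h x)) ^ 2 =
        ψ x * (ψ x * (g x ^ 2 + 2 * (g x * h x) + h x ^ 2)) := fun x => by ring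
    simp_rw [this]
    exact hint (hint ((hg.integrable_sq.add (hgh.const_mul 2)).add hh.integrable_sq))
  have haddI : ∫ x, (ψ x * (g x + h x)) ^ 2 ≤ c ^ 2 * (2 * (N + ∫ x, g x * h x)) := by
    have h1 : c ^ 2 * (2 * (N + ∫ x, g x * h x)) =
        ∫ x, c ^ 2 * (g x ^ 2 + 2 * (g x * h x) + h x ^ 2) := by
      have e1 : Integrable fun x => g x ^ 2 + 2 * (g x * h x) :=
        hg.integrable_sq.add (hgh.const_mul 2)
      rw [integral_const_mul, integral_add e1 hh.integrable_sq,
        integral_add hg.integrable_sq (hgh.const_mul 2), integral_const_mul, hgN, hhN]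
      ring
    rw [h1]
    refine integral_mono hadd
      (((hg.integrable_sq.add (hgh.const_mul 2)).add hh.integrable_sq).const_mul _) fun x => ?_
    have h2 : ψ x ^ 2 ≤ c ^ 2 := sq_le_sq' (abs_le.1 (hc x)).1 (abs_le.1 (hc x)).2
    have h3 := mul_le_mul_of_nonneg_right h2 (sq_nonneg (g x + h x))
    beta_reduce
    nlinarith
  have hprod : ∀ x, (g x - h x) * (ψ x * (g x + h x)) = ψ x * g x ^ 2 - ψ x * h x ^ 2 :=
    fun x => by ring
  have hcs := sq_integral_mul_le hsub hadd (by
    simp_rw [hprod]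
    exact (hint hg.integrable_sq).sub (hint hh.integrable_sq))
  simp_rw [hprod] at hcs
  rw [integral_sub (hint hg.integrable_sq) (hint hh.integrable_sq), hsubI] at hcs
  have hnn : 0 ≤ N - ∫ x, g x * h x := by
    have : 0 ≤ ∫ x, (g x - h x) ^ 2 := integral_nonneg fun _ => sq_nonneg _
    linarith
  have h2 := mul_le_mul_of_nonneg_left haddI (by linarith : 0 ≤ 2 * (N - ∫ x, g x * h x))
  have : 0 ≤ c ^ 2 * (N - ∫ x, g x * h x) := by positivity
  nlinarith [mul_nonneg this hnn]

end Contraction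

section Direction

variable {d : ℕ} [NeZero d]

/-- The direction of a vector (with an arbitrary value at the origin). -/
def dir (x : Euc d) : Sph d :=
  ⟨if x = 0 then EuclideanSpace.single 0 1 else ‖x‖⁻¹ • x, by
    split_ifs with h
    · simp
    · simp [norm_smul, h]⟩

theorem coe_dir {x : Euc d} (hx : x ≠ 0) : (dir x : Euc d) = ‖x‖⁻¹ • x := if_neg hx

theorem measurable_dir : Measurable (dir : Euc d → Sph d) :=
  Measurable.subtype_mk (Measurable.ite (measurableSet_singleton 0) measurable_const
    (measurable_norm.inv.smul measurable_id))

theorem dir_slVec (A : SL d) {x : Euc d} (hx : x ≠ 0) : dir (slVec A x) = sphMap A (dir x) := by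
  have hx' : ‖x‖ ≠ 0 := norm_ne_zero_iff.2 hx
  have hA : slVec A x ≠ 0 := fun h => hx ((slVec_eq_zero_iff A x).1 h)
  refine Subtype.ext ?_
  rw [coe_dir hA, coe_sphMap, coe_dir hx]
  simp only [slVec_smul, norm_smul, norm_inv, norm_norm, smul_smul]
  congr 1
  field_simp

theorem ae_ne_zero : ∀ᵐ x : Euc d, x ≠ 0 := by
  have : Nontrivial (Euc d) := inferInstance
  rw [ae_iff]
  simp

/-- The law of the direction of a vector with density proportional to `f ^ 2`. -/
def dirLaw (f : Euc d → ℝ) : Measure (Sph d) :=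
  (volume.withDensity fun x => ENNReal.ofReal ((∫ y, f y ^ 2)⁻¹ * f x ^ 2)).map dir

theorem IsTestFunction.isProbabilityMeasure_dirLaw {f : Euc d → ℝ} (hf : IsTestFunction f)
    (hN : 0 < ∫ y, f y ^ 2) : IsProbabilityMeasure (dirLaw f) := by
  have : IsProbabilityMeasure
      (volume.withDensity fun x => ENNReal.ofReal ((∫ y, f y ^ 2)⁻¹ * f x ^ 2)) := by
    constructor
    rw [withDensity_apply _ MeasurableSet.univ, Measure.restrict_univ,
      ← ofReal_integral_eq_lintegral_ofReal (hf.integrable_sq.const_mul _)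
        (ae_of_all _ fun x => by positivity), integral_const_mul, inv_mul_cancel₀ hN.ne',
      ENNReal.ofReal_one]
  exact Measure.isProbabilityMeasure_map measurable_dir.aemeasurable

theorem IsTestFunction.integral_comp_sphMap_dirLaw {f : Euc d → ℝ} (hf : IsTestFunction f)
    (φ : C(Sph d, ℝ)) (A : SL d) :
    ∫ y, φ (sphMap A y) ∂dirLaw f =
      (∫ y, f y ^ 2)⁻¹ * ∫ x, φ (dir x) * f (slVec A⁻¹ x) ^ 2 := by
  have hm : Measurable fun x : Euc d => φ (dir x) * f (slVec A⁻¹ x) ^ 2 :=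
    (φ.continuous.measurable.comp measurable_dir).mul
      ((hf.comp_slVec A⁻¹).measurable.pow_const 2)
  have hd : Measurable fun x => ENNReal.ofReal ((∫ y, f y ^ 2)⁻¹ * f x ^ 2) :=
    ((hf.measurable.pow_const 2).const_mul _).ennreal_ofReal
  have hs : Measurable fun y => φ (sphMap A y) :=
    φ.continuous.measurable.comp (measurable_sphMap A)
  rw [dirLaw, integral_map measurable_dir.aemeasurable
      hs.aestronglyMeasurable,
    integral_withDensity_eq_integral_toReal_smul hd (ae_of_all _ fun x => ENNReal.ofReal_lt_top),
    ← integral_comp_slVec A hm, ← integral_const_mul]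
  refine integral_congr_ae ?_
  filter_upwards [ae_ne_zero] with x hx
  have h0 : 0 ≤ (∫ y, f y ^ 2)⁻¹ * f x ^ 2 :=
    mul_nonneg (inv_nonneg.2 (integral_nonneg fun _ => sq_nonneg _)) (sq_nonneg _)
  rw [ENNReal.toReal_ofReal h0, slVec_inv_slVec, dir_slVec A hx, smul_eq_mul]
  ring

/-- If `μ` moves every probability measure on the sphere by a definite amount, then the averaging
operator contracts the `L²` norm by a definite factor. -/
theorem IsTestFunction.integral_translateMean_sq_le {f : Euc d → ℝ} (hf : IsTestFunction f)
    {μ : ProbabilityMeasure (SL d)} {κ : ℝ}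
    (h : ∀ ν, ∃ φ : C(Sph d, ℝ), κ * ‖φ‖ ^ 2 < spread φ μ ν) :
    ∫ x, translateMean (μ : Measure (SL d)) f x ^ 2 ≤ (1 - κ / 8) * ∫ x, f x ^ 2 := by
  have hcorr := integrable_correlation hf (μ : Measure (SL d))
  rw [integral_translateMean_sq hf]
  rcases (integral_nonneg fun _ => sq_nonneg _ : 0 ≤ ∫ x, f x ^ 2).eq_or_lt with hN | hN
  · rw [← hN, mul_zero]
    exact integral_nonpos fun p => (hf.correlation_le p).trans hN.ge
  obtain ⟨φ, hφ⟩ := h ⟨dirLaw f, hf.isProbabilityMeasure_dirLaw hN⟩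
  set N := ∫ x, f x ^ 2 with hNdef
  have hle : spread φ μ ⟨dirLaw f, hf.isProbabilityMeasure_dirLaw hN⟩ ≤
      ∫ p, 8 * ‖φ‖ ^ 2 * (1 - N⁻¹ * correlation f p)
        ∂((μ : Measure (SL d)).prod (μ : Measure (SL d))) := by
    refine integral_mono (integrable_spread φ μ _)
      (((integrable_const _).sub (hcorr.const_mul _)).const_mul _) fun p => ?_
    have h3 := sq_integral_mul_sq_sub_le (hf.comp_slVec p.1⁻¹) (hf.comp_slVec p.2⁻¹)
      (φ.continuous.measurable.comp measurable_dir) (c := ‖φ‖) (N := N)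
      (fun x => φ.norm_coe_le_norm _) (integral_comp_slVec _ (hf.measurable.pow_const 2))
      (integral_comp_slVec _ (hf.measurable.pow_const 2))
    have h4 := mul_le_mul_of_nonneg_left h3 (sq_nonneg N⁻¹)
    simp only [ProbabilityMeasure.coe_mk, hf.integral_comp_sphMap_dirLaw]
    rw [← hNdef]
    refine (le_of_eq ?_).trans (h4.trans (le_of_eq ?_))
    · simp only [Function.comp]
      ring
    · simp only [correlation]
      field_simp
  rw [integral_const_mul, integral_sub (integrable_const _) (hcorr.const_mul _),
    integral_const_mul, integral_const, probReal_univ, one_smul] at hle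
  have hlt := hφ.trans_le hle
  have hpos : 0 < ‖φ‖ ^ 2 := by
    rcases (sq_nonneg ‖φ‖).eq_or_lt with h0 | h0
    · rw [← h0] at hlt
      simp at hlt
    · exact h0
  have h5 : κ < 8 * (1 - N⁻¹ * ∫ p, correlation f p
      ∂((μ : Measure (SL d)).prod (μ : Measure (SL d)))) := by
    nlinarith
  have h6 := mul_le_mul_of_nonneg_left h5.le hN.le
  rw [mul_left_comm, mul_sub, ← mul_assoc N N⁻¹, mul_inv_cancel₀ hN.ne'] at h6
  linarith

end Direction

/-! ### Linear growth of the expected logarithm of the norm -/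

section Growth

variable {d : ℕ}

theorem translateMean_convLaw_succ (μ : ℕ → ProbabilityMeasure (SL d)) (n : ℕ) {f : Euc d → ℝ}
    (hf : IsTestFunction f) : translateMean (convLaw μ (n + 1)) f =
      translateMean (μ n : Measure (SL d)) (translateMean (convLaw μ n) f) := by
  ext1 x
  have hint := hf.integrable_left (convLaw μ (n + 1)) x
  rw [translateMean, convLaw, integral_mconv hint]
  simp only [translateMean, _root_.mul_inv_rev, slVec_mul]

theorem translateMean_convLaw_zero (μ : ℕ → ProbabilityMeasure (SL d)) {f : Euc d → ℝ} :
    translateMean (convLaw μ 0) f = f := by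
  ext1 x
  rw [translateMean, convLaw, integral_dirac, inv_one, slVec_one]

theorem exp_integral_le {X : Type*} [MeasurableSpace X] {m : Measure X} [IsProbabilityMeasure m]
    {g : X → ℝ} (hg : Integrable g m) (he : Integrable (fun x => Real.exp (g x)) m) :
    Real.exp (∫ x, g x ∂m) ≤ ∫ x, Real.exp (g x) ∂m :=
  convexOn_exp.map_integral_le Real.continuous_exp.continuousOn isClosed_univ
    (ae_of_all _ fun _ => Set.mem_univ _) hg he

variable [NeZero d]

theorem integral_translateMean_convLaw_sq_le {K : Set (ProbabilityMeasure (SL d))} {κ ρ : ℝ}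
    (hρ : 0 ≤ ρ) (hκρ : 1 - κ / 8 ≤ ρ)
    (h : ∀ μ ∈ K, ∀ ν, ∃ φ : C(Sph d, ℝ), κ * ‖φ‖ ^ 2 < spread φ μ ν)
    {μ : ℕ → ProbabilityMeasure (SL d)} (hμ : ∀ i, μ i ∈ K) {f : Euc d → ℝ}
    (hf : IsTestFunction f) (n : ℕ) :
    ∫ x, translateMean (convLaw μ n) f x ^ 2 ≤ ρ ^ n * ∫ x, f x ^ 2 := by
  induction n with
  | zero => rw [translateMean_convLaw_zero, pow_zero, one_mul]
  | succ n ih =>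
    rw [translateMean_convLaw_succ μ n hf]
    refine ((hf.isTestFunction_translateMean _).integral_translateMean_sq_le (h _ (hμ n))).trans ?_
    rw [pow_succ', mul_assoc]
    exact (mul_le_mul_of_nonneg_right hκρ (integral_nonneg fun _ => sq_nonneg _)).trans
      (mul_le_mul_of_nonneg_left ih hρ)

/-- The indicator function of the closed unit ball. -/
def ballIndicator (d : ℕ) : Euc d → ℝ := (Metric.closedBall (0 : Euc d) 1).indicator 1

omit [NeZero d] in
theorem isTestFunction_ballIndicator : IsTestFunction (ballIndicator d) where
  measurable := measurable_one.indicator Metric.isClosed_closedBall.measurableSet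
  nonneg _ := Set.indicator_nonneg (fun _ _ => zero_le_one) _
  le_one _ := Set.indicator_le_self' (fun _ _ => zero_le_one) _
  integrable := (integrable_indicator_iff Metric.isClosed_closedBall.measurableSet).2
    (integrableOn_const (hs := measure_closedBall_lt_top.ne))

omit [NeZero d] in
theorem integral_ballIndicator_sq :
    ∫ x, ballIndicator d x ^ 2 = volume.real (Metric.closedBall (0 : Euc d) 1) := by
  have h : ∀ x, ballIndicator d x ^ 2 = ballIndicator d x := by
    intro x
    by_cases hx : x ∈ Metric.closedBall (0 : Euc d) 1 <;> simp [ballIndicator, hx]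
  simp_rw [h]
  exact integral_indicator_one Metric.isClosed_closedBall.measurableSet

theorem le_integral_ballIndicator_mul (A : SL d) :
    volume.real (Metric.closedBall (0 : Euc d) 1) * Real.exp (-(d ^ 2 * Real.log (slNorm A))) ≤
      ∫ x, ballIndicator d x * ballIndicator d (slVec A⁻¹ x) := by
  have hf := isTestFunction_ballIndicator (d := d)
  set r := (slNorm A⁻¹)⁻¹ with hr
  have hr0 : 0 < r := inv_pos.2 (slNorm_pos _)
  have hr1 : r ≤ 1 := inv_le_one_of_one_le₀ (one_le_slNorm _)
  have h1 : volume.real (Metric.closedBall (0 : Euc d) r) =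
      r ^ d * volume.real (Metric.closedBall (0 : Euc d) 1) := by
    rw [Measure.addHaar_real_closedBall' _ _ hr0.le, finrank_euclideanSpace, Fintype.card_fin]
  have h2 : Real.exp (-(d ^ 2 * Real.log (slNorm A))) ≤ r ^ d := by
    have h3 : r ^ d = Real.exp (-(d * Real.log (slNorm A⁻¹))) := by
      rw [hr, inv_pow, Real.exp_neg, mul_comm, Real.exp_mul, Real.exp_log (slNorm_pos _),
        Real.rpow_natCast]
    have h4 : Real.log (slNorm A⁻¹) ≤ (d - 1 : ℕ) * Real.log (slNorm A) := by
      rw [← Real.log_pow]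
      exact Real.log_le_log (slNorm_pos _) (slNorm_inv_le A)
    have h5 : ((d - 1 : ℕ) : ℝ) ≤ d := by exact_mod_cast Nat.sub_le d 1
    rw [h3, Real.exp_le_exp, neg_le_neg_iff, pow_two, mul_assoc]
    exact mul_le_mul_of_nonneg_left
      (h4.trans (mul_le_mul_of_nonneg_right h5 (log_slNorm_nonneg A))) (Nat.cast_nonneg d)
  calc volume.real (Metric.closedBall (0 : Euc d) 1) * Real.exp (-(d ^ 2 * Real.log (slNorm A)))
      ≤ volume.real (Metric.closedBall (0 : Euc d) r) := by
        rw [h1, mul_comm]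
        exact mul_le_mul_of_nonneg_right h2 measureReal_nonneg
    _ = ∫ x, (Metric.closedBall (0 : Euc d) r).indicator 1 x :=
        (integral_indicator_one Metric.isClosed_closedBall.measurableSet).symm
    _ ≤ _ := by
        refine integral_mono ((integrable_indicator_iff
          Metric.isClosed_closedBall.measurableSet).2
            (integrableOn_const (hs := measure_closedBall_lt_top.ne)))
          (hf.integrable_mul (hf.comp_slVec A⁻¹)) fun x => ?_
        by_cases hx : x ∈ Metric.closedBall (0 : Euc d) r
        · have hx1 : ‖x‖ ≤ r := by simpa using hx
          have hx2 : x ∈ Metric.closedBall (0 : Euc d) 1 := by simpa using hx1.trans hr1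
          have hx3 : slVec A⁻¹ x ∈ Metric.closedBall (0 : Euc d) 1 := by
            rw [mem_closedBall_zero_iff]
            refine (norm_slVec_le _ _).trans ((mul_le_mul_of_nonneg_left hx1
              (slNorm_nonneg _)).trans (mul_inv_cancel₀ (slNorm_pos _).ne').le)
          simp [ballIndicator, hx, hx2, hx3]
        · rw [Set.indicator_of_notMem hx]
          exact mul_nonneg (hf.nonneg _) (hf.nonneg _)

omit [NeZero d] in
theorem integrable_ballIndicator_mul_uncurry (ζ : Measure (SL d)) [IsProbabilityMeasure ζ] :
    Integrable (fun p : SL d × Euc d => ballIndicator d p.2 * ballIndicator d (slVec p.1⁻¹ p.2))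
      (ζ.prod volume) := by
  have hf := isTestFunction_ballIndicator (d := d)
  refine Integrable.mono' (hf.integrable_uncurry ζ)
    ((hf.measurable.comp measurable_snd).mul hf.measurable_uncurry).aestronglyMeasurable
    (ae_of_all _ fun p => ?_)
  rw [Real.norm_eq_abs]
  refine (abs_of_nonneg (mul_nonneg (hf.nonneg _) (hf.nonneg _))).le.trans ?_
  exact mul_le_of_le_one_left (hf.nonneg _) (hf.le_one _)

omit [NeZero d] in
theorem integral_ballIndicator_mul_translateMean (ζ : Measure (SL d)) [IsProbabilityMeasure ζ] :
    ∫ x, ballIndicator d x * translateMean ζ (ballIndicator d) x =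
      ∫ A, (∫ x, ballIndicator d x * ballIndicator d (slVec A⁻¹ x)) ∂ζ := by
  simp only [translateMean, ← integral_const_mul]
  exact (integral_integral_swap (integrable_ballIndicator_mul_uncurry ζ)).symm

theorem exists_mul_le_integral_log_slNorm {K : Set (ProbabilityMeasure (SL d))} (hK : IsCompact K)
    (hmeas : ∀ μ ∈ K, MeasuresCondition μ) :
    ∃ lam : ℝ, 0 < lam ∧ ∀ μ : ℕ → ProbabilityMeasure (SL d), (∀ i, μ i ∈ K) → ∀ n,
      Integrable (fun A => Real.log (slNorm A)) (convLaw μ n) →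
        n * lam ≤ ∫ A, Real.log (slNorm A) ∂convLaw μ n := by
  obtain ⟨κ, hκ, h⟩ := exists_lt_spread hK hmeas
  set ρ := max (1 - κ / 8) (1 / 2) with hρ
  have hρ0 : 0 < ρ := lt_max_of_lt_right (by norm_num)
  have hρ1 : ρ < 1 := max_lt (by linarith) (by norm_num)
  have hd : (0 : ℝ) < d := by exact_mod_cast NeZero.pos d
  refine ⟨-Real.log ρ / (2 * d ^ 2), div_pos (neg_pos.2 (Real.log_neg hρ0 hρ1)) (by positivity),
    fun μ hμ n hint => ?_⟩
  have hf := isTestFunction_ballIndicator (d := d)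
  set V := volume.real (Metric.closedBall (0 : Euc d) 1) with hV
  have hV0 : 0 < V := by
    refine ENNReal.toReal_pos ?_ measure_closedBall_lt_top.ne
    exact (Metric.measure_closedBall_pos volume (0 : Euc d) one_pos).ne'
  set ℓ := ∫ A, Real.log (slNorm A) ∂convLaw μ n with hℓ
  have hg := hf.isTestFunction_translateMean (convLaw μ n)
  have hcs := sq_integral_mul_le hf.integrable_sq hg.integrable_sq (hf.integrable_mul hg)
  rw [integral_ballIndicator_sq, ← hV] at hcs
  have hcontr := integral_translateMean_convLaw_sq_le hρ0.le (le_max_left _ _) h hμ hf n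
  rw [integral_ballIndicator_sq, ← hV] at hcontr
  have hm : Measurable fun A : SL d => Real.exp (-(d ^ 2 * Real.log (slNorm A))) :=
    ((continuous_slNorm.measurable.log).const_mul _).neg.exp
  have hexp : Integrable (fun A : SL d => Real.exp (-(d ^ 2 * Real.log (slNorm A))))
      (convLaw μ n) := by
    refine Integrable.of_bound hm.aestronglyMeasurable 1 (ae_of_all _ fun A => ?_)
    rw [Real.norm_eq_abs, Real.abs_exp, Real.exp_le_one_iff, neg_nonpos]
    exact mul_nonneg (by positivity) (log_slNorm_nonneg A)
  have hjensen := exp_integral_le (hint.const_mul (d ^ 2 : ℝ)).neg hexp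
  simp only [Pi.neg_apply] at hjensen
  rw [integral_neg, integral_const_mul, ← hℓ] at hjensen
  have hlow : V * Real.exp (-(d ^ 2 * ℓ)) ≤
      ∫ x, ballIndicator d x * translateMean (convLaw μ n) (ballIndicator d) x := by
    rw [integral_ballIndicator_mul_translateMean]
    refine (mul_le_mul_of_nonneg_left hjensen hV0.le).trans ?_
    rw [← integral_const_mul]
    refine integral_mono (hexp.const_mul V) ?_ fun A => le_integral_ballIndicator_mul A
    exact (integrable_ballIndicator_mul_uncurry _).integral_prod_left
  have hsq := pow_le_pow_left₀ (by positivity) hlow 2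
  have h1 : Real.exp (-(d ^ 2 * ℓ)) ^ 2 ≤ ρ ^ n := by
    have h2 : V ^ 2 * Real.exp (-(d ^ 2 * ℓ)) ^ 2 ≤ V ^ 2 * ρ ^ n := by
      rw [← mul_pow]
      refine hsq.trans (hcs.trans ((mul_le_mul_of_nonneg_left hcontr hV0.le).trans ?_))
      exact (by ring : V * (ρ ^ n * V) = V ^ 2 * ρ ^ n).le
    exact le_of_mul_le_mul_left h2 (by positivity)
  have h3 := Real.log_le_log (by positivity) h1
  rw [Real.log_pow, Real.log_exp, Real.log_pow] at h3
  rw [mul_div_assoc', div_le_iff₀ (by positivity)]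
  push_cast at h3
  linarith

end Growth

/-! ### Exponential moments -/

section Moments

theorem exp_le_one_add_add_sq_mul (x : ℝ) : Real.exp x ≤ 1 + x + x ^ 2 * Real.exp |x| := by
  have h1 := Real.one_le_exp (abs_nonneg x)
  rcases le_total 0 (1 + x) with h | h
  · have h2 : (1 + x) * (1 - x) ≤ (1 + x) * Real.exp (-x) :=
      mul_le_mul_of_nonneg_left (by linarith [Real.add_one_le_exp (-x)]) h
    have h3 := mul_le_mul_of_nonneg_right h2 (Real.exp_pos x).le
    rw [mul_assoc, mul_assoc, ← Real.exp_add, neg_add_cancel, Real.exp_zero] at h3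
    have h4 := mul_le_mul_of_nonneg_left (Real.exp_le_exp.2 (le_abs_self x)) (sq_nonneg x)
    nlinarith
  · have h2 : Real.exp x ≤ 1 := Real.exp_le_one_iff.2 (by linarith)
    nlinarith [sq_nonneg x]

variable {d : ℕ} [NeZero d]

/-- The exponential moment of order `γ` of `log ‖A‖` is at most `M`. -/
def HasExpMomentLE (γ M : ℝ) (ζ : Measure (SL d)) : Prop :=
  ∫⁻ A, ENNReal.ofReal (Real.exp (γ * Real.log (slNorm A))) ∂ζ ≤ ENNReal.ofReal M

omit [NeZero d] in
theorem measurable_log_slNorm : Measurable fun A : SL d => Real.log (slNorm A) :=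
  continuous_slNorm.measurable.log

omit [NeZero d] in
theorem measurable_exp_log_slNorm (γ : ℝ) :
    Measurable fun A : SL d => Real.exp (γ * Real.log (slNorm A)) :=
  (measurable_log_slNorm.const_mul γ).exp

theorem FiniteMomentCondition.hasExpMomentLE {γ C : ℝ} {μ : ProbabilityMeasure (SL d)}
    (h : FiniteMomentCondition γ C μ) : HasExpMomentLE γ C (μ : Measure (SL d)) := by
  refine (le_of_eq (lintegral_congr fun A => ?_)).trans h.le
  rw [Real.rpow_def_of_pos (slNorm_pos A), mul_comm]

section

variable {γ M : ℝ} {ζ : Measure (SL d)} [IsProbabilityMeasure ζ]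

theorem HasExpMomentLE.one_le (hγ : 0 ≤ γ) (h : HasExpMomentLE γ M ζ) : 1 ≤ M := by
  have h1 : (1 : ℝ≥0∞) ≤ ENNReal.ofReal M := by
    refine le_trans ?_ h
    calc (1 : ℝ≥0∞) = ∫⁻ _ : SL d, 1 ∂ζ := by simp
      _ ≤ _ := lintegral_mono fun A => by
        rw [ENNReal.one_le_ofReal, Real.one_le_exp_iff]
        exact mul_nonneg hγ (log_slNorm_nonneg A)
  exact ENNReal.one_le_ofReal.1 h1

omit [NeZero d] [IsProbabilityMeasure ζ] in
theorem HasExpMomentLE.integrable (h : HasExpMomentLE γ M ζ) :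
    Integrable (fun A => Real.exp (γ * Real.log (slNorm A))) ζ := by
  refine ⟨(measurable_exp_log_slNorm γ).aestronglyMeasurable, ?_⟩
  rw [hasFiniteIntegral_iff_ofReal (ae_of_all _ fun A => (Real.exp_pos _).le)]
  exact h.trans_lt ENNReal.ofReal_lt_top

theorem HasExpMomentLE.integral_le (hγ : 0 ≤ γ) (h : HasExpMomentLE γ M ζ) :
    ∫ A, Real.exp (γ * Real.log (slNorm A)) ∂ζ ≤ M := by
  have h1 := h
  rw [HasExpMomentLE, ← ofReal_integral_eq_lintegral_ofReal h.integrable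
    (ae_of_all _ fun A => (Real.exp_pos _).le)] at h1
  exact (ENNReal.ofReal_le_ofReal_iff (zero_le_one.trans (h.one_le hγ))).1 h1

omit [NeZero d] [IsProbabilityMeasure ζ] in
theorem HasExpMomentLE.integrable_of_abs_le (hγ : 0 < γ) (h : HasExpMomentLE γ M ζ)
    {Y : SL d → ℝ} (hY : Measurable Y) {D : ℝ} (hD : 0 ≤ D)
    (hYD : ∀ A, |Y A| ≤ D * Real.log (slNorm A)) : Integrable Y ζ := by
  refine Integrable.mono' (h.integrable.const_mul (D / γ)) hY.aestronglyMeasurable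
    (ae_of_all _ fun A => ?_)
  rw [Real.norm_eq_abs]
  refine (hYD A).trans ?_
  have h1 := Real.add_one_le_exp (γ * Real.log (slNorm A))
  rw [div_mul_eq_mul_div, mul_div_assoc]
  refine mul_le_mul_of_nonneg_left ?_ hD
  rw [le_div_iff₀ hγ]
  linarith

omit [IsProbabilityMeasure ζ] in
theorem HasExpMomentLE.integrable_log (hγ : 0 < γ) (h : HasExpMomentLE γ M ζ) :
    Integrable (fun A => Real.log (slNorm A)) ζ :=
  h.integrable_of_abs_le hγ measurable_log_slNorm zero_le_one fun A => by
    rw [abs_of_nonneg (log_slNorm_nonneg A), one_mul]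

theorem HasExpMomentLE.integral_log_le (hγ : 0 < γ) (h : HasExpMomentLE γ M ζ) :
    ∫ A, Real.log (slNorm A) ∂ζ ≤ Real.log M / γ := by
  have h1 := (exp_integral_le ((h.integrable_log hγ).const_mul γ) h.integrable).trans
    (h.integral_le hγ.le)
  rw [integral_const_mul, ← Real.le_log_iff_exp_le (zero_lt_one.trans_le (h.one_le hγ.le))] at h1
  rw [le_div_iff₀ hγ]
  linarith

/-- A quantitative bound for the Laplace transform near zero. -/
theorem HasExpMomentLE.lintegral_exp_le (hγ : 0 < γ) (h : HasExpMomentLE γ M ζ)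
    {Y : SL d → ℝ} (hY : Measurable Y) {D : ℝ} (hD : 0 ≤ D)
    (hYD : ∀ A, |Y A| ≤ D * Real.log (slNorm A)) {s : ℝ} (hs : 0 ≤ s) (hsD : s * D ≤ γ / 2) :
    ∫⁻ A, ENNReal.ofReal (Real.exp (s * Y A)) ∂ζ ≤
      ENNReal.ofReal (Real.exp (s * ∫ A, Y A ∂ζ + s ^ 2 * (8 * D ^ 2 * M / γ ^ 2))) := by
  have hYI := h.integrable_of_abs_le hγ hY hD hYD
  have hpt : ∀ A, Real.exp (s * Y A) ≤ 1 + s * Y A +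
      s ^ 2 * (8 * D ^ 2 / γ ^ 2) * Real.exp (γ * Real.log (slNorm A)) := by
    intro A
    set x := Real.log (slNorm A) with hx
    have hx0 : 0 ≤ x := log_slNorm_nonneg A
    have h1 : |s * Y A| ≤ γ / 2 * x := by
      rw [abs_mul, abs_of_nonneg hs]
      refine (mul_le_mul_of_nonneg_left (hYD A) hs).trans ?_
      rw [← mul_assoc]
      exact mul_le_mul_of_nonneg_right hsD hx0
    have h2 : (s * Y A) ^ 2 ≤ s ^ 2 * D ^ 2 * x ^ 2 := by
      have : |s * Y A| ≤ s * D * x := by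
        rw [abs_mul, abs_of_nonneg hs, mul_assoc]
        exact mul_le_mul_of_nonneg_left (hYD A) hs
      rw [← sq_abs, ← mul_pow, ← mul_pow]
      exact pow_le_pow_left₀ (abs_nonneg _) this 2
    have h3 : x ^ 2 ≤ 8 / γ ^ 2 * Real.exp (γ / 2 * x) := by
      have := Real.quadratic_le_exp_of_nonneg (x := γ / 2 * x) (by positivity)
      rw [div_mul_eq_mul_div, le_div_iff₀ (by positivity)]
      nlinarith [mul_nonneg hγ.le hx0]
    have h4 : Real.exp |s * Y A| ≤ Real.exp (γ / 2 * x) := Real.exp_le_exp.2 h1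
    have h5 : Real.exp (γ * x) = Real.exp (γ / 2 * x) * Real.exp (γ / 2 * x) := by
      rw [← Real.exp_add]
      ring_nf
    have h6 : (s * Y A) ^ 2 * Real.exp |s * Y A| ≤
        s ^ 2 * D ^ 2 * (8 / γ ^ 2 * Real.exp (γ / 2 * x)) * Real.exp (γ / 2 * x) :=
      mul_le_mul (h2.trans (mul_le_mul_of_nonneg_left h3 (by positivity))) h4
        (Real.exp_pos _).le (by positivity)
    refine (exp_le_one_add_add_sq_mul _).trans ?_
    rw [h5]
    refine add_le_add le_rfl (h6.trans (le_of_eq ?_))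
    ring
  have hI1 : Integrable (fun A => 1 + s * Y A) ζ := (integrable_const _).add (hYI.const_mul s)
  have hI2 := h.integrable.const_mul (s ^ 2 * (8 * D ^ 2 / γ ^ 2))
  have hR : Integrable (fun A => 1 + s * Y A +
      s ^ 2 * (8 * D ^ 2 / γ ^ 2) * Real.exp (γ * Real.log (slNorm A))) ζ := hI1.add hI2
  refine (lintegral_mono fun A => ENNReal.ofReal_le_ofReal (hpt A)).trans ?_
  rw [← ofReal_integral_eq_lintegral_ofReal hR
    (ae_of_all _ fun A => (Real.exp_pos _).le.trans (hpt A))]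
  refine ENNReal.ofReal_le_ofReal ?_
  rw [integral_add hI1 hI2, integral_add (integrable_const _) (hYI.const_mul s),
    integral_const_mul, integral_const_mul, integral_const, probReal_univ, one_smul]
  have h7 := mul_le_mul_of_nonneg_left (h.integral_le hγ.le)
    (by positivity : 0 ≤ s ^ 2 * (8 * D ^ 2 / γ ^ 2))
  refine le_trans ?_ (Real.add_one_le_exp _)
  have h8 : s ^ 2 * (8 * D ^ 2 / γ ^ 2) * M = s ^ 2 * (8 * D ^ 2 * M / γ ^ 2) := by ring
  linarith

end

theorem HasExpMomentLE.convLaw {γ C : ℝ} (hγ : 0 ≤ γ) {μ : ℕ → ProbabilityMeasure (SL d)}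
    (h : ∀ i, HasExpMomentLE γ C (μ i : Measure (SL d))) (n : ℕ) :
    HasExpMomentLE γ (C ^ n) (convLaw μ n) := by
  induction n with
  | zero =>
    rw [HasExpMomentLE, _root_.convLaw,
      lintegral_dirac' _ (measurable_exp_log_slNorm γ).ennreal_ofReal]
    simp [slNorm_one]
  | succ n ih =>
    have hm := (measurable_exp_log_slNorm (d := d) γ).ennreal_ofReal
    have hC : 0 ≤ C := zero_le_one.trans ((h 0).one_le hγ)
    rw [HasExpMomentLE, _root_.convLaw, Measure.lintegral_mconv hm]
    calc _ ≤ ∫⁻ A, ∫⁻ B, ENNReal.ofReal (Real.exp (γ * Real.log (slNorm A))) *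
          ENNReal.ofReal (Real.exp (γ * Real.log (slNorm B))) ∂_root_.convLaw μ n
            ∂(μ n : Measure (SL d)) := by
          refine lintegral_mono fun A => lintegral_mono fun B => ?_
          rw [← ENNReal.ofReal_mul (Real.exp_pos _).le, ← Real.exp_add, ← mul_add]
          exact ENNReal.ofReal_le_ofReal (Real.exp_le_exp.2
            (mul_le_mul_of_nonneg_left (log_slNorm_mul_le A B) hγ))
      _ ≤ ENNReal.ofReal C * ENNReal.ofReal (C ^ n) := by
          simp_rw [lintegral_const_mul _ hm]
          rw [lintegral_mul_const _ hm]
          exact mul_le_mul' (h n) ih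
      _ = ENNReal.ofReal (C ^ (n + 1)) := by rw [← ENNReal.ofReal_mul hC, pow_succ']

end Moments

/-! ### The norm is comparable to the growth of each vector -/

section Comparison

variable {d : ℕ} [NeZero d]

theorem exists_slNorm_mul_abs_inner_le (Q : SL d) :
    ∃ w : Sph d, ∀ x : Euc d, slNorm Q * |⟪(w : Euc d), x⟫| ≤ ‖slVec Q x‖ := by
  have hne : (Metric.sphere (0 : Euc d) 1).Nonempty := (NormedSpace.sphere_nonempty).2 zero_le_one
  obtain ⟨v, hv, hmax⟩ := (isCompact_sphere (0 : Euc d) 1).exists_isMaxOn hne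
    (ContinuousLinearMap.adjoint (slCLM Q)).continuous.norm.continuousOn
  set P := ContinuousLinearMap.adjoint (slCLM Q) with hP
  have hv1 : ‖v‖ = 1 := mem_sphere_zero_iff_norm.1 hv
  have hle : slNorm Q ≤ ‖P v‖ := by
    rw [slNorm_eq, ← ContinuousLinearMap.adjoint.norm_map (slCLM Q)]
    exact ContinuousLinearMap.opNorm_le_of_unit_norm (norm_nonneg _) fun x hx =>
      hmax (mem_sphere_zero_iff_norm.2 hx)
  have hpos : 0 < ‖P v‖ := (slNorm_pos Q).trans_le hle
  refine ⟨⟨‖P v‖⁻¹ • P v, by simp [norm_smul, hpos.ne']⟩, fun x => ?_⟩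
  have h1 : |⟪P v, x⟫| ≤ ‖slVec Q x‖ := by
    rw [hP, ContinuousLinearMap.adjoint_inner_left]
    refine (abs_real_inner_le_norm _ _).trans ?_
    rw [hv1, one_mul, slVec_eq]
  have h2 : |⟪‖P v‖⁻¹ • P v, x⟫| = ‖P v‖⁻¹ * |⟪P v, x⟫| := by
    rw [real_inner_smul_left, abs_mul, abs_of_pos (inv_pos.2 hpos)]
  calc slNorm Q * |⟪‖P v‖⁻¹ • P v, x⟫| = slNorm Q * ‖P v‖⁻¹ * |⟪P v, x⟫| := by rw [h2, mul_assoc]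
    _ ≤ 1 * ‖slVec Q x‖ := by
      refine mul_le_mul ?_ h1 (abs_nonneg _) zero_le_one
      rw [← div_eq_mul_inv, div_le_one hpos]
      exact hle
    _ = _ := one_mul _

theorem log_slNorm_sub_log_norm_le (Q : SL d) (x : Sph d) :
    Real.log (slNorm Q) - Real.log ‖slVec Q x‖ ≤ d * Real.log (slNorm Q) := by
  have h := neg_log_norm_slVec_le Q x
  rw [Nat.cast_sub NeZero.one_le, Nat.cast_one] at h
  linarith

omit [NeZero d] in
theorem log_slNorm_sub_log_norm_nonneg (Q : SL d) (x : Sph d) :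
    0 ≤ Real.log (slNorm Q) - Real.log ‖slVec Q x‖ :=
  sub_nonneg.2 (Real.log_le_log (norm_slVec_pos Q x) (norm_slVec_le_slNorm Q x))

theorem log_slNorm_sub_log_norm_mul_le (Q B : SL d) (u : Sph d) :
    Real.log (slNorm (Q * B)) - Real.log ‖slVec (Q * B) u‖ ≤
      d * Real.log (slNorm B) +
        (Real.log (slNorm Q) - Real.log ‖slVec Q (sphMap B u)‖) := by
  rw [norm_slVec_mul, Real.log_mul (norm_slVec_pos _ _).ne' (norm_slVec_pos _ _).ne']
  have h1 := log_slNorm_mul_le Q B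
  have h2 := log_slNorm_sub_log_norm_le B u
  linarith

theorem exists_log_slNorm_sub_log_norm_le (Q : SL d) {δ : ℝ} (hδ : 0 < δ) :
    ∃ w : Sph d, ∀ x : Sph d, δ < |⟪(w : Euc d), (x : Euc d)⟫| →
      Real.log (slNorm Q) - Real.log ‖slVec Q x‖ ≤ -Real.log δ := by
  obtain ⟨w, hw⟩ := exists_slNorm_mul_abs_inner_le Q
  refine ⟨w, fun x hx => ?_⟩
  have h1 : slNorm Q * δ ≤ ‖slVec Q x‖ :=
    (mul_le_mul_of_nonneg_left hx.le (slNorm_nonneg Q)).trans (hw x)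
  have h2 := Real.log_le_log (mul_pos (slNorm_pos Q) hδ) h1
  rw [Real.log_mul (slNorm_pos Q).ne' hδ.ne'] at h2
  linarith

omit [NeZero d] in
theorem measurable_log_norm_slVec (u : Sph d) :
    Measurable fun A : SL d => Real.log ‖slVec A u‖ :=
  (Continuous.slVec_apply continuous_id continuous_const).norm.measurable.log

theorem lintegral_mul_log_slNorm_convLaw_le {γ C : ℝ} (hγ : 0 < γ)
    {μ : ℕ → ProbabilityMeasure (SL d)}
    (h : ∀ i, HasExpMomentLE γ C (μ i : Measure (SL d))) (n : ℕ) {D : ℝ} (hD : 0 ≤ D) :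
    ∫⁻ A, ENNReal.ofReal (D * Real.log (slNorm A)) ∂convLaw μ n ≤
      ENNReal.ofReal (D * (n * (Real.log C / γ))) := by
  have hn := HasExpMomentLE.convLaw hγ.le h n
  rw [← ofReal_integral_eq_lintegral_ofReal ((hn.integrable_log hγ).const_mul D)
    (ae_of_all _ fun A => mul_nonneg hD (log_slNorm_nonneg A)), integral_const_mul]
  refine ENNReal.ofReal_le_ofReal (mul_le_mul_of_nonneg_left ?_ hD)
  refine (hn.integral_log_le hγ).trans (le_of_eq ?_)
  rw [Real.log_pow, mul_div_assoc]

theorem lintegral_log_slNorm_sub_convLaw_add_le {γ C : ℝ} (hγ : 0 < γ) (hC : 1 ≤ C)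
    {μ : ℕ → ProbabilityMeasure (SL d)} (h : ∀ i, HasExpMomentLE γ C (μ i : Measure (SL d)))
    {m : ℕ} {δ ε : ℝ} (hδ : 0 < δ) (hε : 0 ≤ ε)
    (hm : ∀ u w : Sph d, convLaw μ m {A | |⟪(w : Euc d), (sphMap A u : Euc d)⟫| ≤ δ} ≤
      ENNReal.ofReal ε) (r : ℕ) (u : Sph d) :
    ∫⁻ A, ENNReal.ofReal (Real.log (slNorm A) - Real.log ‖slVec A u‖) ∂convLaw μ (m + r) ≤
      ENNReal.ofReal (d * (m * (Real.log C / γ)) + max (-Real.log δ) 0 +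
        d * (r * (Real.log C / γ)) * ε) := by
  have hlog : 0 ≤ Real.log C / γ := div_nonneg (Real.log_nonneg hC) hγ.le
  have hmeas : Measurable fun A : SL d =>
      ENNReal.ofReal (Real.log (slNorm A) - Real.log ‖slVec A u‖) :=
    (measurable_log_slNorm.sub (measurable_log_norm_slVec u)).ennreal_ofReal
  have hX : Measurable fun A : SL d => ENNReal.ofReal (d * Real.log (slNorm A)) :=
    (measurable_log_slNorm.const_mul _).ennreal_ofReal
  rw [convLaw_add, Measure.lintegral_mconv hmeas]
  have hQ : ∀ Q : SL d, ∫⁻ B, ENNReal.ofReal (Real.log (slNorm (Q * B)) -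
      Real.log ‖slVec (Q * B) u‖) ∂convLaw μ m ≤
        ENNReal.ofReal (d * (m * (Real.log C / γ)) + max (-Real.log δ) 0) +
          ENNReal.ofReal (d * Real.log (slNorm Q)) * ENNReal.ofReal ε := by
    intro Q
    obtain ⟨w, hw⟩ := exists_log_slNorm_sub_log_norm_le Q hδ
    set S := {B : SL d | |⟪(w : Euc d), (sphMap B u : Euc d)⟫| ≤ δ} with hS
    have hSm : MeasurableSet S := by
      have h1 : Measurable fun B : SL d => |⟪(w : Euc d), (sphMap B u : Euc d)⟫| := by
        have h2 : Continuous fun x : Sph d => |⟪(w : Euc d), (x : Euc d)⟫| := by fun_prop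
        exact h2.measurable.comp (measurable_sphMap_left u)
      exact h1 measurableSet_Iic
    calc _ ≤ ∫⁻ B, (ENNReal.ofReal (d * Real.log (slNorm B)) +
          (ENNReal.ofReal (max (-Real.log δ) 0) +
            S.indicator (fun _ => ENNReal.ofReal (d * Real.log (slNorm Q))) B)) ∂convLaw μ m := by
          refine lintegral_mono fun B => ?_
          refine (ENNReal.ofReal_le_ofReal (log_slNorm_sub_log_norm_mul_le Q B u)).trans
            (ENNReal.ofReal_add_le.trans (add_le_add le_rfl ?_))
          by_cases hB : B ∈ S
          · rw [Set.indicator_of_mem hB]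
            exact (ENNReal.ofReal_le_ofReal (log_slNorm_sub_log_norm_le Q _)).trans le_add_self
          · exact (ENNReal.ofReal_le_ofReal ((hw _ (not_le.1 hB)).trans
              (le_max_left _ 0))).trans le_self_add
      _ ≤ _ := by
          rw [lintegral_add_left hX, lintegral_add_left measurable_const, lintegral_const,
            measure_univ, mul_one, lintegral_indicator_const hSm, ← add_assoc,
            ENNReal.ofReal_add (by positivity) (le_max_right _ _)]
          exact add_le_add (add_le_add
            (lintegral_mul_log_slNorm_convLaw_le hγ h m (Nat.cast_nonneg d)) le_rfl)
            (mul_le_mul' le_rfl (hm u w))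
  refine (lintegral_mono hQ).trans ?_
  rw [lintegral_add_left measurable_const, lintegral_const, measure_univ, mul_one,
    lintegral_mul_const _ hX,
    ENNReal.ofReal_add (q := d * (r * (Real.log C / γ)) * ε) (by positivity) (by positivity),
    ENNReal.ofReal_mul (q := ε) (by positivity)]
  exact add_le_add le_rfl (mul_le_mul'
    (lintegral_mul_log_slNorm_convLaw_le hγ (fun i => h (m + i)) r (Nat.cast_nonneg d)) le_rfl)

theorem exists_lintegral_log_slNorm_sub_le {K : Set (ProbabilityMeasure (SL d))} (hK : IsCompact K)
    (hsp : ∀ μ ∈ K, SpacesCondition μ) {γ C : ℝ} (hγ : 0 < γ) (hC : 1 ≤ C)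
    (hmom : ∀ μ ∈ K, HasExpMomentLE γ C (μ : Measure (SL d))) {η : ℝ} (hη : 0 < η) :
    ∃ m : ℕ, 0 < m ∧ ∀ μ : ℕ → ProbabilityMeasure (SL d), (∀ i, μ i ∈ K) → ∀ u : Sph d,
      ∫⁻ A, ENNReal.ofReal (Real.log (slNorm A) - Real.log ‖slVec A u‖) ∂convLaw μ m ≤
        ENNReal.ofReal (η * m) := by
  have hlog : 0 ≤ Real.log C / γ := div_nonneg (Real.log_nonneg hC) hγ.le
  set c := d * (Real.log C / γ) with hc
  have hc0 : 0 ≤ c := by positivity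
  set ε := η / (2 * (c + 1)) with hε
  have hε0 : 0 < ε := by positivity
  have hcε : c * ε ≤ η / 2 := by
    rw [hε, mul_div_assoc', div_le_div_iff₀ (by positivity) (by positivity)]
    nlinarith
  obtain ⟨m, δ, hδ, hm⟩ := exists_uniform_measure_near_hyperplane_le hK hsp
    (ENNReal.ofReal_pos.2 hε0).ne'
  obtain ⟨r, hr⟩ := exists_nat_ge ((c * m + max (-Real.log δ) 0) / (η / 2))
  refine ⟨m + (r + 1), by omega, fun μ hμ u => ?_⟩
  refine (lintegral_log_slNorm_sub_convLaw_add_le hγ hC (fun i => hmom _ (hμ i)) hδ hε0.le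
    (hm μ hμ) (r + 1) u).trans (ENNReal.ofReal_le_ofReal ?_)
  rw [div_le_iff₀ (by positivity)] at hr
  have h1 : (0 : ℝ) ≤ r := Nat.cast_nonneg r
  have h2 : (0 : ℝ) ≤ m := Nat.cast_nonneg m
  have h3 := mul_le_mul_of_nonneg_right hcε (by positivity : (0 : ℝ) ≤ r + 1)
  push_cast
  nlinarith

end Comparison

/-! ### Large deviations -/

section Deviations

variable {d : ℕ} [NeZero d]

theorem abs_log_norm_slVec_le (A : SL d) (u : Sph d) :
    |-Real.log ‖slVec A u‖| ≤ d * Real.log (slNorm A) := by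
  have h0 := log_slNorm_nonneg A
  have h1 := log_slNorm_sub_log_norm_le A u
  have h2 := log_slNorm_sub_log_norm_nonneg A u
  have h3 : (1 : ℝ) ≤ d := by exact_mod_cast NeZero.one_le
  have h4 := mul_le_mul_of_nonneg_right h3 h0
  rw [abs_le]
  constructor <;> linarith

theorem abs_log_slNorm_le (A : SL d) :
    |Real.log (slNorm A)| ≤ d * Real.log (slNorm A) := by
  rw [abs_of_nonneg (log_slNorm_nonneg A)]
  exact le_mul_of_one_le_left (log_slNorm_nonneg A) (by exact_mod_cast NeZero.one_le)

/-- The Laplace transforms of `log ‖A‖` and of `-log ‖A u‖` at `s`, for a random matrix `A` with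
law `ζ`, are at most those of the constants `Λ` and `-Λ`, up to a factor `exp a`. -/
structure LaplaceLE (s Λ a : ℝ) (ζ : Measure (SL d)) : Prop where
  norm_le : ∫⁻ A, ENNReal.ofReal (Real.exp (s * Real.log (slNorm A))) ∂ζ ≤
    ENNReal.ofReal (Real.exp (s * Λ + a))
  vec_le : ∀ u : Sph d, ∫⁻ A, ENNReal.ofReal (Real.exp (s * -Real.log ‖slVec A u‖)) ∂ζ ≤
    ENNReal.ofReal (Real.exp (-(s * Λ) + a))

theorem LaplaceLE.mconv {s Λ₁ Λ₂ a₁ a₂ : ℝ} {ζ₁ ζ₂ : Measure (SL d)} [IsProbabilityMeasure ζ₁]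
    [IsProbabilityMeasure ζ₂] (hs : 0 ≤ s) (h₁ : LaplaceLE s Λ₁ a₁ ζ₁) (h₂ : LaplaceLE s Λ₂ a₂ ζ₂) :
    LaplaceLE s (Λ₁ + Λ₂) (a₁ + a₂) (ζ₂ ∗ₘ ζ₁) where
  norm_le := by
    have hm := (measurable_exp_log_slNorm (d := d) s).ennreal_ofReal
    rw [Measure.lintegral_mconv hm]
    calc _ ≤ ∫⁻ A, ∫⁻ B, ENNReal.ofReal (Real.exp (s * Real.log (slNorm A))) *
          ENNReal.ofReal (Real.exp (s * Real.log (slNorm B))) ∂ζ₁ ∂ζ₂ := by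
          refine lintegral_mono fun A => lintegral_mono fun B => ?_
          rw [← ENNReal.ofReal_mul (Real.exp_pos _).le, ← Real.exp_add, ← mul_add]
          exact ENNReal.ofReal_le_ofReal (Real.exp_le_exp.2
            (mul_le_mul_of_nonneg_left (log_slNorm_mul_le A B) hs))
      _ ≤ ENNReal.ofReal (Real.exp (s * Λ₂ + a₂)) * ENNReal.ofReal (Real.exp (s * Λ₁ + a₁)) := by
          simp_rw [lintegral_const_mul _ hm]
          rw [lintegral_mul_const _ hm]
          exact mul_le_mul' h₂.norm_le h₁.norm_le
      _ = _ := by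
          rw [← ENNReal.ofReal_mul (Real.exp_pos _).le, ← Real.exp_add]
          congr 2
          ring
  vec_le u := by
    have hm : ∀ v : Sph d, Measurable fun A : SL d =>
        ENNReal.ofReal (Real.exp (s * -Real.log ‖slVec A v‖)) := fun v =>
      ((measurable_log_norm_slVec v).neg.const_mul s).exp.ennreal_ofReal
    have hmul : AEMeasurable (Function.uncurry fun A B : SL d =>
        ENNReal.ofReal (Real.exp (s * -Real.log ‖slVec (A * B) u‖))) (ζ₂.prod ζ₁) :=
      ((hm u).comp measurable_mul).aemeasurable
    rw [Measure.lintegral_mconv (hm u), lintegral_lintegral_swap hmul]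
    calc _ = ∫⁻ B, ENNReal.ofReal (Real.exp (s * -Real.log ‖slVec B u‖)) *
          ∫⁻ A, ENNReal.ofReal (Real.exp (s * -Real.log ‖slVec A (sphMap B u)‖)) ∂ζ₂ ∂ζ₁ := by
          refine lintegral_congr fun B => ?_
          rw [← lintegral_const_mul _ (hm _)]
          refine lintegral_congr fun A => ?_
          rw [← ENNReal.ofReal_mul (Real.exp_pos _).le, ← Real.exp_add, norm_slVec_mul,
            Real.log_mul (norm_slVec_pos _ _).ne' (norm_slVec_pos _ _).ne']
          congr 2
          ring
      _ ≤ ∫⁻ B, ENNReal.ofReal (Real.exp (s * -Real.log ‖slVec B u‖)) *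
          ENNReal.ofReal (Real.exp (-(s * Λ₂) + a₂)) ∂ζ₁ :=
          lintegral_mono fun B => mul_le_mul' le_rfl (h₂.vec_le _)
      _ ≤ ENNReal.ofReal (Real.exp (-(s * Λ₁) + a₁)) *
          ENNReal.ofReal (Real.exp (-(s * Λ₂) + a₂)) := by
          rw [lintegral_mul_const _ (hm u)]
          exact mul_le_mul' (h₁.vec_le u) le_rfl
      _ = _ := by
          rw [← ENNReal.ofReal_mul (Real.exp_pos _).le, ← Real.exp_add]
          congr 2
          ring

theorem HasExpMomentLE.laplaceLE {γ M : ℝ} {ζ : Measure (SL d)} [IsProbabilityMeasure ζ]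
    (hγ : 0 ≤ γ) (h : HasExpMomentLE γ M ζ) {s a : ℝ} (hs : 0 ≤ s) (hsd : s * d ≤ γ)
    (ha : Real.log M ≤ a) : LaplaceLE s 0 a ζ := by
  have key : ∀ Y : SL d → ℝ, (∀ A, |Y A| ≤ d * Real.log (slNorm A)) →
      ∫⁻ A, ENNReal.ofReal (Real.exp (s * Y A)) ∂ζ ≤ ENNReal.ofReal (Real.exp a) := by
    intro Y hY
    refine le_trans (lintegral_mono fun A => ENNReal.ofReal_le_ofReal (Real.exp_le_exp.2 ?_))
      (h.trans (ENNReal.ofReal_le_ofReal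
        ((Real.log_le_iff_le_exp (zero_lt_one.trans_le (h.one_le hγ))).1 ha)))
    calc s * Y A ≤ s * (d * Real.log (slNorm A)) :=
          mul_le_mul_of_nonneg_left ((le_abs_self _).trans (hY A)) hs
      _ = s * d * Real.log (slNorm A) := by ring
      _ ≤ _ := mul_le_mul_of_nonneg_right hsd (log_slNorm_nonneg A)
  constructor
  · simpa using key _ abs_log_slNorm_le
  · intro u
    simpa using key _ fun A => abs_log_norm_slVec_le A u

theorem HasExpMomentLE.laplaceLE_integral {γ M : ℝ} {ζ : Measure (SL d)} [IsProbabilityMeasure ζ]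
    (hγ : 0 < γ) (h : HasExpMomentLE γ M ζ) {b : ℝ} (hb : 0 ≤ b)
    (hζ : ∀ u : Sph d, ∫⁻ A, ENNReal.ofReal (Real.log (slNorm A) - Real.log ‖slVec A u‖) ∂ζ ≤
      ENNReal.ofReal b) {s : ℝ} (hs : 0 ≤ s) (hsd : s * d ≤ γ / 2)
    (hsb : s * (8 * d ^ 2 * M / γ ^ 2) ≤ b) :
    LaplaceLE s (∫ A, Real.log (slNorm A) ∂ζ) (2 * (s * b)) ζ := by
  have hsb' := mul_le_mul_of_nonneg_left hsb hs
  have hd : (0 : ℝ) ≤ d := Nat.cast_nonneg d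
  constructor
  · refine (h.lintegral_exp_le hγ measurable_log_slNorm hd abs_log_slNorm_le hs hsd).trans
      (ENNReal.ofReal_le_ofReal (Real.exp_le_exp.2 ?_))
    nlinarith [mul_nonneg hs hb]
  · intro u
    have hY := measurable_log_norm_slVec u
    have hI := h.integrable_of_abs_le hγ hY.neg hd fun A => abs_log_norm_slVec_le A u
    have hlog := h.integrable_log hγ
    refine (h.lintegral_exp_le hγ hY.neg hd (fun A => abs_log_norm_slVec_le A u) hs hsd).trans
      (ENNReal.ofReal_le_ofReal (Real.exp_le_exp.2 ?_))
    have h1 := hζ u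
    have hI' : Integrable (fun A => Real.log (slNorm A) - Real.log ‖slVec A u‖) ζ := by
      simp only [sub_eq_add_neg]
      exact hlog.add hI
    rw [← ofReal_integral_eq_lintegral_ofReal hI'
      (ae_of_all _ fun A => log_slNorm_sub_log_norm_nonneg A u), ENNReal.ofReal_le_ofReal_iff hb]
      at h1
    have h2 : ∫ A, (Real.log (slNorm A) - Real.log ‖slVec A u‖) ∂ζ =
        ∫ A, Real.log (slNorm A) ∂ζ + ∫ A, -Real.log ‖slVec A u‖ ∂ζ := by
      simp only [sub_eq_add_neg]
      exact integral_add hlog hI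
    rw [h2] at h1
    have h3 := mul_le_mul_of_nonneg_left h1 hs
    simp only [Pi.neg_apply]
    nlinarith

theorem exists_laplaceLE_convLaw {K : Set (ProbabilityMeasure (SL d))} (hK : IsCompact K)
    (hsp : ∀ μ ∈ K, SpacesCondition μ) {γ C : ℝ} (hγ : 0 < γ) (hC : 1 ≤ C)
    (hmom : ∀ μ ∈ K, HasExpMomentLE γ C (μ : Measure (SL d))) {η : ℝ} (hη : 0 < η) :
    ∃ s c : ℝ, 0 < s ∧ ∀ μ : ℕ → ProbabilityMeasure (SL d), (∀ i, μ i ∈ K) → ∀ n : ℕ,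
      ∃ Λ : ℝ, LaplaceLE s Λ (s * (η * n) + c) (convLaw μ n) := by
  have hd : (0 : ℝ) < d := by exact_mod_cast NeZero.pos d
  obtain ⟨m, hm0, hm⟩ := exists_lintegral_log_slNorm_sub_le hK hsp hγ hC hmom (half_pos hη)
  have hm0' : (0 : ℝ) < m := by exact_mod_cast hm0
  set B := 8 * (d : ℝ) ^ 2 * C ^ m / γ ^ 2 with hB
  have hB0 : 0 < B := by positivity
  set s := min (γ / 2 / d) (η / 2 * m / B) with hs
  have hs0 : 0 < s := lt_min (by positivity) (by positivity)
  have hsd : s * d ≤ γ / 2 := by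
    rw [← le_div_iff₀ hd]
    exact min_le_left _ _
  have hsB : s * B ≤ η / 2 * m := by
    rw [← le_div_iff₀ hB0]
    exact min_le_right _ _
  refine ⟨s, m * Real.log C, hs0, fun μ hμ n => ?_⟩
  induction n using Nat.strong_induction_on with
  | _ n ih =>
    have hmomn : ∀ (μ : ℕ → ProbabilityMeasure (SL d)), (∀ i, μ i ∈ K) → ∀ n,
        HasExpMomentLE γ (C ^ n) (convLaw μ n) := fun μ hμ n =>
      HasExpMomentLE.convLaw hγ.le (fun i => hmom _ (hμ i)) n
    rcases lt_or_ge n m with hnm | hnm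
    · refine ⟨0, (hmomn μ hμ n).laplaceLE hγ.le hs0.le (by linarith) ?_⟩
      rw [Real.log_pow]
      have h1 : (n : ℝ) ≤ m := by exact_mod_cast hnm.le
      have h2 := mul_le_mul_of_nonneg_right h1 (Real.log_nonneg hC)
      have h3 : 0 ≤ s * (η * n) := by positivity
      linarith
    · obtain ⟨k, rfl⟩ := Nat.exists_eq_add_of_le' hnm
      obtain ⟨Λ, hΛ⟩ := ih k (by omega)
      have hblock := (hmomn (fun i => μ (k + i)) (fun i => hμ _) m).laplaceLE_integral hγ
        (by positivity) (hm (fun i => μ (k + i)) fun i => hμ _) hs0.le hsd hsB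
      have := hΛ.mconv hs0.le hblock
      rw [← convLaw_add] at this
      refine ⟨Λ + ∫ A, Real.log (slNorm A) ∂convLaw (fun i => μ (k + i)) m, ?_⟩
      convert this using 1
      push_cast
      ring

end Deviations

/-! ### The law of large numbers -/

section LawOfLargeNumbers

theorem measure_le_of_lintegral_exp_le {X : Type*} [MeasurableSpace X] {m : Measure X} {Y : X → ℝ}
    (hY : Measurable Y) {b : ℝ}
    (h : ∫⁻ x, ENNReal.ofReal (Real.exp (Y x)) ∂m ≤ ENNReal.ofReal (Real.exp b)) (t : ℝ) :
    m {x | t ≤ Y x} ≤ ENNReal.ofReal (Real.exp (b - t)) := by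
  have h1 := (mul_meas_ge_le_lintegral (μ := m) hY.exp.ennreal_ofReal
    (ENNReal.ofReal (Real.exp t))).trans h
  simp only [ENNReal.ofReal_le_ofReal_iff (Real.exp_pos _).le, Real.exp_le_exp] at h1
  rw [Real.exp_sub, ENNReal.ofReal_div_of_pos (Real.exp_pos t),
    ENNReal.le_div_iff_mul_le (Or.inl (by simp [Real.exp_pos])) (Or.inl ENNReal.ofReal_ne_top),
    mul_comm]
  exact h1

theorem integral_le_of_lintegral_exp_le {X : Type*} [MeasurableSpace X] {m : Measure X}
    [IsProbabilityMeasure m] {Y : X → ℝ} (hY : Measurable Y) (hI : Integrable Y m) {b : ℝ}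
    (h : ∫⁻ x, ENNReal.ofReal (Real.exp (Y x)) ∂m ≤ ENNReal.ofReal (Real.exp b)) :
    ∫ x, Y x ∂m ≤ b := by
  have hpos : 0 ≤ᵐ[m] fun x => Real.exp (Y x) := ae_of_all _ fun x => (Real.exp_pos _).le
  have hexp : Integrable (fun x => Real.exp (Y x)) m := by
    refine ⟨hY.exp.aestronglyMeasurable, ?_⟩
    rw [hasFiniteIntegral_iff_ofReal hpos]
    exact h.trans_lt ENNReal.ofReal_lt_top
  rw [← ofReal_integral_eq_lintegral_ofReal hexp hpos,
    ENNReal.ofReal_le_ofReal_iff (Real.exp_pos _).le] at h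
  exact Real.exp_le_exp.1 ((exp_integral_le hI hexp).trans h)

theorem IsProductMeasure.L_eq {d : ℕ} {μ : ℕ → ProbabilityMeasure (SL d)} {ℙ : Measure (ℕ → SL d)}
    (h : IsProductMeasure μ ℙ) (n : ℕ) : L ℙ n = ∫ A, Real.log (slNorm A) ∂convLaw μ n := by
  rw [← h.map_T, integral_map (measurable_T n).aemeasurable
    measurable_log_slNorm.aestronglyMeasurable, L]

variable {d : ℕ} [NeZero d]

theorem LaplaceLE.measure_le {s Λ a : ℝ} {ζ : Measure (SL d)} [IsProbabilityMeasure ζ]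
    (hs : 0 < s) (h : LaplaceLE s Λ a ζ) (hI : Integrable (fun A => Real.log (slNorm A)) ζ)
    (δ : ℝ) :
    ζ {A | δ ≤ |Real.log (slNorm A) - ∫ B, Real.log (slNorm B) ∂ζ|} ≤
      2 * ENNReal.ofReal (Real.exp (2 * a - s * δ)) := by
  set I := ∫ B, Real.log (slNorm B) ∂ζ with hIdef
  have hm := measurable_log_slNorm (d := d)
  have hneg : ∫⁻ A, ENNReal.ofReal (Real.exp (s * -Real.log (slNorm A))) ∂ζ ≤
      ENNReal.ofReal (Real.exp (-(s * Λ) + a)) := by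
    refine (lintegral_mono fun A => ENNReal.ofReal_le_ofReal (Real.exp_le_exp.2 ?_)).trans
      (h.vec_le (dir 0))
    have := log_slNorm_sub_log_norm_nonneg A (dir 0)
    exact mul_le_mul_of_nonneg_left (by linarith) hs.le
  have h1 := integral_le_of_lintegral_exp_le (hm.const_mul s) (hI.const_mul s) h.norm_le
  have h2 := integral_le_of_lintegral_exp_le (hm.neg.const_mul s) (hI.neg.const_mul s) hneg
  simp only [Pi.neg_apply, integral_const_mul, integral_neg, ← hIdef] at h1 h2
  have h3 := measure_le_of_lintegral_exp_le (hm.const_mul s) h.norm_le (s * (I + δ))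
  have h4 := measure_le_of_lintegral_exp_le (hm.neg.const_mul s) hneg (s * (-I + δ))
  have hsub : {A : SL d | δ ≤ |Real.log (slNorm A) - I|} ⊆
      {A | s * (I + δ) ≤ s * Real.log (slNorm A)} ∪
        {A | s * (-I + δ) ≤ s * -Real.log (slNorm A)} := by
    intro A hA
    rcases le_abs.1 (show δ ≤ |Real.log (slNorm A) - I| from hA) with hA | hA
    · exact Or.inl (mul_le_mul_of_nonneg_left (by linarith) hs.le)
    · exact Or.inr (mul_le_mul_of_nonneg_left (by linarith) hs.le)
  refine (measure_mono hsub).trans ((measure_union_le _ _).trans ?_)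
  rw [two_mul]
  refine add_le_add (h3.trans ?_) (h4.trans ?_) <;>
  · refine ENNReal.ofReal_le_ofReal (Real.exp_le_exp.2 ?_)
    linarith

theorem ae_eventually_abs_sub_lt {K : Set (ProbabilityMeasure (SL d))} (hK : IsCompact K)
    (hsp : ∀ μ ∈ K, SpacesCondition μ) {γ C : ℝ} (hγ : 0 < γ) (hC : 1 ≤ C)
    (hmom : ∀ μ ∈ K, HasExpMomentLE γ C (μ : Measure (SL d)))
    {μ : ℕ → ProbabilityMeasure (SL d)} (hμ : ∀ i, μ i ∈ K) {ℙ : Measure (ℕ → SL d)}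
    (hP : IsProductMeasure μ ℙ) {η : ℝ} (hη : 0 < η) :
    ∀ᵐ ω ∂ℙ, ∀ᶠ n : ℕ in atTop, |Real.log (slNorm (T ω n)) - L ℙ n| < 4 * (η * n) := by
  obtain ⟨s, c, hs, h⟩ := exists_laplaceLE_convLaw hK hsp hγ hC hmom hη
  have hbound : ∀ n : ℕ, ℙ {ω | 4 * (η * n) ≤ |Real.log (slNorm (T ω n)) - L ℙ n|} ≤
      ENNReal.ofReal (2 * Real.exp (2 * c) * Real.exp (-(2 * s * η)) ^ n) := by
    intro n
    obtain ⟨Λ, hΛ⟩ := h μ hμ n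
    have h1 := hΛ.measure_le hs
      ((HasExpMomentLE.convLaw hγ.le (fun i => hmom _ (hμ i)) n).integrable_log hγ) (4 * (η * n))
    rw [← hP.L_eq, ← hP.map_T, Measure.map_apply (measurable_T n)
      (measurableSet_le measurable_const (measurable_log_slNorm.sub_const _).abs)] at h1
    refine h1.trans (le_of_eq ?_)
    rw [← Real.exp_nat_mul, mul_assoc, ← Real.exp_add, ENNReal.ofReal_mul zero_le_two,
      ENNReal.ofReal_ofNat]
    congr 3
    ring
  have hsum : Summable fun n : ℕ => 2 * Real.exp (2 * c) * Real.exp (-(2 * s * η)) ^ n :=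
    (summable_geometric_of_lt_one (Real.exp_pos _).le
      (Real.exp_lt_one_iff.2 (neg_lt_zero.2 (by positivity)))).mul_left _
  filter_upwards [ae_eventually_notMem
    (ne_top_of_le_ne_top hsum.tsum_ofReal_ne_top (ENNReal.tsum_le_tsum hbound))] with ω hω
  filter_upwards [hω] with n hn
  exact not_le.1 hn

theorem ae_tendsto_log_slNorm_sub_div {K : Set (ProbabilityMeasure (SL d))} (hK : IsCompact K)
    (hsp : ∀ μ ∈ K, SpacesCondition μ) {γ C : ℝ} (hγ : 0 < γ) (hC : 1 ≤ C)
    (hmom : ∀ μ ∈ K, HasExpMomentLE γ C (μ : Measure (SL d)))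
    {μ : ℕ → ProbabilityMeasure (SL d)} (hμ : ∀ i, μ i ∈ K) {ℙ : Measure (ℕ → SL d)}
    (hP : IsProductMeasure μ ℙ) :
    ∀ᵐ ω ∂ℙ, Tendsto (fun n : ℕ => (Real.log (slNorm (T ω n)) - L ℙ n) / n) atTop (𝓝 0) := by
  have h : ∀ᵐ ω ∂ℙ, ∀ k : ℕ, ∀ᶠ n : ℕ in atTop,
      |Real.log (slNorm (T ω n)) - L ℙ n| < 4 * (1 / ((k : ℝ) + 1) * n) :=
    ae_all_iff.2 fun k => ae_eventually_abs_sub_lt hK hsp hγ hC hmom hμ hP (by positivity)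
  filter_upwards [h] with ω hω
  rw [Metric.tendsto_nhds]
  intro ε hε
  obtain ⟨k, hk⟩ := exists_nat_one_div_lt (show 0 < ε / 4 by positivity)
  filter_upwards [hω k, eventually_gt_atTop 0] with n hn hn0
  have hn0' : (0 : ℝ) < n := by exact_mod_cast hn0
  rw [Real.dist_eq, sub_zero, abs_div, abs_of_pos hn0', div_lt_iff₀ hn0']
  have := mul_lt_mul_of_pos_right hk hn0'
  linarith

end LawOfLargeNumbers

/-- **Non-stationary Furstenberg theorem** (Theorem 1.1).
Under the finite moment, measures, and spaces conditions on the compact set `K`,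
there is `λ > 0` with `Lₙ ≥ n λ` for every `n` and every choice of measures from `K`;
moreover, for any fixed sequence of measures from `K`, almost surely
`(1/n)(log ‖Tₙ‖ - Lₙ) → 0`. -/
theorem nonstationary_furstenberg
    (d : ℕ) (hd : 0 < d)
    (K : Set (ProbabilityMeasure (SL d))) (hK : IsCompact K)
    (γ C : ℝ) (hγ : 0 < γ)
    (hmom : ∀ μ ∈ K, FiniteMomentCondition γ C μ)
    (hmeas : ∀ μ ∈ K, MeasuresCondition μ)
    (hsp : ∀ μ ∈ K, SpacesCondition μ) :
    ∃ lam : ℝ, 0 < lam ∧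
      ∀ (μ : ℕ → ProbabilityMeasure (SL d)), (∀ i, μ i ∈ K) →
        ∀ ℙ : Measure (ℕ → SL d), IsProductMeasure μ ℙ →
          (∀ n : ℕ, (n : ℝ) * lam ≤ L ℙ n) ∧
          (∀ᵐ ω ∂ℙ, Tendsto (fun n : ℕ => (Real.log (slNorm (T ω n)) - L ℙ n) / n)
            atTop (nhds 0)) := by
  have : NeZero d := ⟨hd.ne'⟩
  have hexp : ∀ μ ∈ K, HasExpMomentLE γ C (μ : Measure (SL d)) := fun μ hμ =>
    (hmom μ hμ).hasExpMomentLE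
  obtain ⟨lam, hlam, h⟩ := exists_mul_le_integral_log_slNorm hK hmeas
  refine ⟨lam, hlam, fun μ hμ ℙ hP => ⟨fun n => ?_, ?_⟩⟩
  · rw [hP.L_eq]
    exact h μ hμ n
      ((HasExpMomentLE.convLaw hγ.le (fun i => hexp _ (hμ i)) n).integrable_log hγ)
  · exact ae_tendsto_log_slNorm_sub_div hK hsp hγ ((hexp _ (hμ 0)).one_le hγ.le) hexp hμ hP
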